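/- Every neighbourly normal 3-pseudomanifold on 8 vertices is isomorphic to exactly one of the 19 complexes S^3_{8,35}, S^3_{8,36}, S^3_{8,37}, S^3_{8,38}, N_1, N_2, …, N_15; in particular these 19 complexes are pairwise non-isomorphic neighbourly normal 3-pseudomanifolds on 8 vertices. -/

import Mathlib

/-! Basic framework for finite simplicial complexes, pseudomanifolds and
bistellar moves, following Datta–Nilakantan. A complex is recorded as the
finite set of its faces (nonempty finite subsets of the vertex type). -/

namespace NPM

variable {α β : Type*} [DecidableEq α] [DecidableEq β]

/-- A "complex" datum: a finite family of finite subsets of `α`. -/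
abbrev Complex (α : Type*) := Finset (Finset α)

/-- `K` is a simplicial complex: a nonempty collection of nonempty sets,
closed under passing to nonempty subsets. -/
def IsComplex (K : Complex α) : Prop :=
  K.Nonempty ∧ (∀ σ ∈ K, σ.Nonempty) ∧ ∀ σ ∈ K, ∀ τ ⊆ σ, τ.Nonempty → τ ∈ K

/-- The vertex set of `K`. -/
def verts (K : Complex α) : Finset α := K.sup id

/-- `K` is pure of dimension `d`: every face is contained in a face with
`d+1` vertices. -/
def IsPure (K : Complex α) (d : ℕ) : Prop :=
  ∀ σ ∈ K, ∃ τ ∈ K, σ ⊆ τ ∧ τ.card = d + 1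

/-- The facets ("`d`-faces") of a pure `d`-dimensional complex. -/
def facets (K : Complex α) (d : ℕ) : Complex α := K.filter (fun σ => σ.card = d + 1)

/-- The link of a face `σ` in `K`. -/
def link (K : Complex α) (σ : Finset α) : Complex α :=
  K.filter (fun τ => Disjoint τ σ ∧ σ ∪ τ ∈ K)

/-- The degree of a face: the number of vertices of its link. -/
def degree (K : Complex α) (σ : Finset α) : ℕ := (verts (link K σ)).card

/-- A weak `d`-pseudomanifold: a pure `d`-dimensional complex in which every
`(d-1)`-face (i.e. face with `d` vertices) lies in exactly two facets. -/
def WeakPM (K : Complex α) (d : ℕ) : Prop :=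
  IsComplex K ∧ IsPure K d ∧
    ∀ σ ∈ K, σ.card = d → (K.filter fun τ => σ ⊆ τ ∧ τ.card = d + 1).card = 2

/-- Strong connectedness: any two facets are joined by a chain of facets in
which consecutive facets meet in a `(d-1)`-face. -/
def SConn (K : Complex α) (d : ℕ) : Prop :=
  ∀ σ ∈ facets K d, ∀ τ ∈ facets K d,
    Relation.ReflTransGen
      (fun a b => a ∈ facets K d ∧ b ∈ facets K d ∧ (a ∩ b).card = d) σ τ

/-- A `d`-pseudomanifold: a strongly connected weak `d`-pseudomanifold. -/
def IsPM (K : Complex α) (d : ℕ) : Prop := WeakPM K d ∧ SConn K d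

/-- Connectedness of a complex: the graph of vertices and edges is connected. -/
def Conn (K : Complex α) : Prop :=
  (verts K).Nonempty ∧ ∀ u ∈ verts K, ∀ v ∈ verts K,
    Relation.ReflTransGen (fun a b => a ≠ b ∧ ({a, b} : Finset α) ∈ K) u v

/-- A normal `d`-pseudomanifold: a connected weak `d`-pseudomanifold in which
the link of every face of dimension `≤ d - 2` is connected. -/
def NormalPM (K : Complex α) (d : ℕ) : Prop :=
  WeakPM K d ∧ Conn K ∧ ∀ σ ∈ K, σ.card + 1 ≤ d → Conn (link K σ)

/-- `K` is neighbourly: every pair of vertices forms an edge. -/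
def Neighbourly (K : Complex α) : Prop :=
  ∀ u ∈ verts K, ∀ v ∈ verts K, u ≠ v → ({u, v} : Finset α) ∈ K

/-- Isomorphism of complexes: a map injective on the vertex set carrying the
faces of `K` exactly onto the faces of `L`. -/
def Iso (K : Complex α) (L : Complex β) : Prop :=
  ∃ f : α → β, Set.InjOn f ↑(verts K) ∧ L = K.image (fun σ => σ.image f)

/-- The complex generated by a family of facets: all nonempty subsets. -/
def genCx (F : Finset (Finset α)) : Complex α :=
  F.biUnion fun σ => σ.powerset.filter (fun τ => τ.Nonempty)

/-- The standard sphere on the vertex set `B`: all nonempty proper subsets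
of `B`. -/
def stdSphere (B : Finset α) : Complex α :=
  B.powerset.filter fun τ => τ.Nonempty ∧ τ ≠ B

/-- In a weak `d`-pseudomanifold, a removable `(d-i)`-face `A`: its link is a
standard sphere `S^{i-1}_{i+1}(B)` with `B` not a face.  (For `d = 3`,
`i = 1` gives removable 2-faces and `i = 2` gives removable 1-faces.) -/
def RemovableFace (d i : ℕ) (K : Complex α) (A : Finset α) : Prop :=
  A ∈ K ∧ A.card = d - i + 1 ∧
    ∃ B : Finset α, B.card = i + 1 ∧ B ∉ K ∧ link K A = stdSphere B

/-- The bistellar `i`-move (`0 < i ≤ d`) relation on weak `d`-pseudomanifolds: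
`L` is obtained from `K` by removing a removable `(d-i)`-face `A` with
`link K A = stdSphere B` and inserting the facets `(B ∪ A) \ {v}`, `v ∈ A`. -/
def BMove (d i : ℕ) (K L : Complex α) : Prop :=
  ∃ A B : Finset α, A ∈ K ∧ A.card = d - i + 1 ∧ B.card = i + 1 ∧ B ∉ K ∧
    link K A = stdSphere B ∧
    L = genCx ((facets K d).filter (fun σ => ¬ A ⊆ σ) ∪
          A.image fun v => (B ∪ A).erase v)

/-- The bistellar `0`-move: star a new vertex `w` in a facet `σ`. -/
def BMove0 (d : ℕ) (K L : Complex α) : Prop :=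
  ∃ σ w, σ ∈ K ∧ σ.card = d + 1 ∧ w ∉ verts K ∧
    L = genCx (((facets K d).erase σ) ∪ σ.image fun v => insert w (σ.erase v))

/-- A single bistellar move of any type `0 ≤ i ≤ d`. -/
def BStep (d : ℕ) (K L : Complex α) : Prop :=
  BMove0 d K L ∨ ∃ i, 0 < i ∧ i ≤ d ∧ BMove d i K L

/-- Bistellar equivalence: a finite sequence of bistellar moves. -/
def BEquiv (d : ℕ) : Complex α → Complex α → Prop :=
  Relation.ReflTransGen (BStep d)

/-- A proper bistellar move: a bistellar `i`-move with `0 < i < d`. -/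
def PMove (d : ℕ) (K L : Complex α) : Prop := ∃ i, 0 < i ∧ i < d ∧ BMove d i K L

/-- Proper bistellar equivalence. -/
def PEquiv (d : ℕ) : Complex α → Complex α → Prop :=
  Relation.ReflTransGen (PMove d)

/-- The result of the bistellar move on the face `A` of the weak
`d`-pseudomanifold `K` (deterministic form: `B` is the vertex set of
`link K A`). -/
def kappa (d : ℕ) (K : Complex α) (A : Finset α) : Complex α :=
  genCx ((facets K d).filter (fun σ => ¬ A ⊆ σ) ∪
    A.image fun v => (verts (link K A) ∪ A).erase v)

/-- A cycle: a (finite) 1-pseudomanifold. -/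
def Cycle (K : Complex α) : Prop := IsPM K 1

/-- A combinatorial 2-manifold: a weak 2-pseudomanifold all whose vertex
links are cycles. -/
def Comb2Mfd (K : Complex α) : Prop :=
  WeakPM K 2 ∧ ∀ v, ({v} : Finset α) ∈ K → Cycle (link K {v})

/-- The Euler characteristic `f₀ - f₁ + f₂` of a 2-dimensional complex. -/
def eulerChar (K : Complex α) : ℤ :=
  ((K.filter fun σ => σ.card = 1).card : ℤ) -
    ((K.filter fun σ => σ.card = 2).card : ℤ) +
    ((K.filter fun σ => σ.card = 3).card : ℤ)

/-- A combinatorial 2-sphere: a connected combinatorial 2-manifold with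
Euler characteristic 2. -/
def Comb2Sphere (K : Complex α) : Prop := Comb2Mfd K ∧ Conn K ∧ eulerChar K = 2

/-- A combinatorial 3-manifold: a 3-pseudomanifold all whose vertex links are
combinatorial 2-spheres. -/
def Comb3Mfd (K : Complex α) : Prop :=
  IsPM K 3 ∧ ∀ v, ({v} : Finset α) ∈ K → Comb2Sphere (link K {v})

end NPM

/-- The complex `S35` from the paper, generated by its facets. -/
def S35 : NPM.Complex ℕ :=
  NPM.genCx {{1,2,3,4}, {1,2,6,7}, {1,2,5,6}, {1,2,4,5}, {2,3,4,5}, {2,3,5,6}, {2,3,6,7}, {3,4,6,7}, {3,4,5,6}, {4,5,6,7}, {1,2,3,8}, {1,2,7,8}, {2,3,7,8}, {1,3,4,8}, {3,4,7,8}, {1,4,5,8}, {4,5,7,8}, {1,5,6,8}, {1,6,7,8}, {5,6,7,8}}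
/-- The complex `S36` from the paper, generated by its facets. -/
def S36 : NPM.Complex ℕ :=
  NPM.genCx {{1,2,3,4}, {1,2,5,6}, {1,2,4,5}, {1,5,6,7}, {2,3,4,5}, {2,3,5,6}, {2,3,6,7}, {3,4,6,7}, {3,4,5,6}, {4,5,6,7}, {1,2,6,8}, {1,6,7,8}, {2,6,7,8}, {1,2,3,8}, {2,3,7,8}, {1,3,4,8}, {3,4,7,8}, {1,4,5,8}, {1,5,7,8}, {4,5,7,8}}
/-- The complex `S37` from the paper, generated by its facets. -/
def S37 : NPM.Complex ℕ :=
  NPM.genCx {{1,2,3,4}, {1,2,5,6}, {1,2,4,5}, {1,4,5,7}, {2,3,4,5}, {2,3,5,6}, {2,3,6,7}, {3,4,6,7}, {3,4,5,6}, {4,5,6,7}, {1,5,6,8}, {1,5,7,8}, {5,6,7,8}, {1,2,6,8}, {2,6,7,8}, {1,2,3,8}, {2,3,7,8}, {1,3,4,8}, {1,4,7,8}, {3,4,7,8}}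
/-- The complex `S38` from the paper, generated by its facets. -/
def S38 : NPM.Complex ℕ :=
  NPM.genCx {{1,2,3,4}, {1,2,3,7}, {1,2,6,7}, {1,3,4,7}, {1,5,6,7}, {2,3,4,5}, {2,3,6,7}, {3,4,6,7}, {3,4,5,6}, {4,5,6,7}, {2,3,5,8}, {2,3,6,8}, {3,5,6,8}, {1,2,6,8}, {1,5,6,8}, {1,2,4,8}, {2,4,5,8}, {1,4,7,8}, {1,5,7,8}, {4,5,7,8}}
/-- The complex `N1` from the paper, generated by its facets. -/
def N1 : NPM.Complex ℕ :=
  NPM.genCx {{1,2,4,8}, {1,2,6,8}, {1,3,4,8}, {1,3,7,8}, {1,5,6,8}, {1,5,7,8}, {2,3,5,8}, {2,3,7,8}, {2,4,5,8}, {2,6,7,8}, {3,4,6,8}, {3,5,6,8}, {4,5,7,8}, {4,6,7,8}, {1,2,4,7}, {1,2,5,7}, {1,3,6,7}, {1,4,6,7}, {2,3,4,7}, {2,5,6,7}, {3,4,5,7}, {3,5,6,7}, {1,2,3,6}, {2,3,4,6}, {1,3,4,5}, {1,2,3,5}, {1,4,5,6}, {2,4,5,6}}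
/-- The complex `N2` from the paper, generated by its facets. -/
def N2 : NPM.Complex ℕ :=
  NPM.genCx {{1,2,4,8}, {2,4,5,8}, {2,3,5,8}, {3,5,6,8}, {3,4,6,8}, {4,6,7,8}, {4,5,7,8}, {1,5,7,8}, {1,5,6,8}, {1,2,6,8}, {2,6,7,8}, {2,3,7,8}, {1,3,7,8}, {1,3,4,8}, {1,2,4,7}, {2,4,5,7}, {2,3,5,7}, {3,5,6,7}, {3,4,6,7}, {1,5,6,7}, {1,2,6,7}, {1,3,4,7}}
/-- The complex `N3` from the paper, generated by its facets. -/
def N3 : NPM.Complex ℕ :=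
  NPM.genCx {{1,2,4,8}, {1,2,6,8}, {1,3,4,8}, {1,3,7,8}, {1,5,6,8}, {1,5,7,8}, {2,3,5,8}, {2,3,7,8}, {2,4,5,8}, {2,6,7,8}, {3,4,6,8}, {3,5,6,8}, {4,5,7,8}, {4,6,7,8}, {1,2,3,4}, {2,3,4,7}, {2,4,5,6}, {2,4,6,7}, {3,4,5,6}, {3,4,5,7}, {1,2,3,5}, {1,2,5,6}, {1,3,5,7}}
/-- The complex `N4` from the paper, generated by its facets. -/
def N4 : NPM.Complex ℕ :=
  NPM.genCx {{1,2,4,8}, {1,2,6,8}, {1,3,4,8}, {1,3,7,8}, {1,5,6,8}, {1,5,7,8}, {2,3,5,8}, {2,3,7,8}, {2,4,5,8}, {2,6,7,8}, {3,4,6,8}, {3,5,6,8}, {4,5,7,8}, {4,6,7,8}, {1,2,4,5}, {1,2,5,6}, {2,3,5,6}, {2,3,6,7}, {3,4,6,7}, {1,3,4,7}, {1,4,5,7}}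
/-- The complex `N5` from the paper, generated by its facets. -/
def N5 : NPM.Complex ℕ :=
  NPM.genCx {{1,2,5,8}, {1,2,6,8}, {1,3,5,8}, {1,3,7,8}, {1,4,6,8}, {1,4,7,8}, {2,3,6,8}, {2,3,7,8}, {2,4,5,8}, {2,4,7,8}, {3,4,5,8}, {3,4,6,8}, {1,2,5,7}, {1,2,6,7}, {1,3,6,7}, {1,4,5,7}, {2,3,5,7}, {2,4,6,7}, {3,4,5,7}, {3,4,6,7}, {2,3,5,6}, {2,4,5,6}, {1,3,5,6}, {1,4,5,6}}
/-- The complex `N6` from the paper, generated by its facets. -/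
def N6 : NPM.Complex ℕ :=
  NPM.genCx {{1,3,5,8}, {1,3,7,8}, {1,4,6,8}, {1,4,7,8}, {1,5,6,8}, {2,3,6,8}, {2,3,7,8}, {2,4,5,8}, {2,4,7,8}, {2,5,6,8}, {3,4,5,8}, {3,4,6,8}, {1,2,3,5}, {1,2,4,5}, {1,4,5,7}, {1,5,6,7}, {2,3,5,7}, {2,5,6,7}, {3,4,5,7}, {1,2,3,6}, {1,2,4,6}, {1,3,6,7}, {2,4,6,7}, {3,4,6,7}}
/-- The complex `N7` from the paper, generated by its facets. -/
def N7 : NPM.Complex ℕ :=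
  NPM.genCx {{1,2,6,8}, {1,2,5,8}, {1,3,5,8}, {1,3,7,8}, {1,4,7,8}, {1,4,6,8}, {2,3,7,8}, {2,3,6,8}, {2,4,5,8}, {2,4,7,8}, {3,4,6,8}, {3,4,5,8}, {1,3,5,6}, {1,3,6,7}, {2,3,5,7}, {2,3,5,6}, {3,4,6,7}, {3,4,5,7}, {1,2,5,6}, {1,4,6,7}, {2,4,5,7}}
/-- `N_8 = κ_{348}(κ_{238}(κ_{56}(κ_{67}(N_7))))`. -/
def N8 : NPM.Complex ℕ :=
  NPM.kappa 3 (NPM.kappa 3 (NPM.kappa 3 (NPM.kappa 3 N7 {6,7}) {5,6}) {2,3,8}) {3,4,8}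
/-- `N_9 = κ_{235}(κ_{67}(N_7))`. -/
def N9 : NPM.Complex ℕ := NPM.kappa 3 (NPM.kappa 3 N7 {6,7}) {2,3,5}
/-- `N_10 = κ_{148}(κ_{67}(N_7))`. -/
def N10 : NPM.Complex ℕ := NPM.kappa 3 (NPM.kappa 3 N7 {6,7}) {1,4,8}
/-- `N_11 = κ_{348}(κ_{56}(N_10))`. -/
def N11 : NPM.Complex ℕ := NPM.kappa 3 (NPM.kappa 3 N10 {5,6}) {3,4,8}
/-- `N_12 = κ_{457}(κ_{23}(N_9))`. -/
def N12 : NPM.Complex ℕ := NPM.kappa 3 (NPM.kappa 3 N9 {2,3}) {4,5,7}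
/-- `N_13 = κ_{567}(κ_{23}(N_9))`. -/
def N13 : NPM.Complex ℕ := NPM.kappa 3 (NPM.kappa 3 N9 {2,3}) {5,6,7}
/-- `N_14 = κ_{138}(κ_{57}(N_8))`. -/
def N14 : NPM.Complex ℕ := NPM.kappa 3 (NPM.kappa 3 N8 {5,7}) {1,3,8}
/-- `N_15 = κ_{158}(κ_{23}(N_9))`. -/
def N15 : NPM.Complex ℕ := NPM.kappa 3 (NPM.kappa 3 N9 {2,3}) {1,5,8}

/-- The list of the 19 neighbourly normal 3-pseudomanifolds on 8 vertices. -/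
def L19 : List (NPM.Complex ℕ) :=
  [S35, S36, S37, S38, N1, N2, N3, N4, N5, N6, N7, N8, N9, N10, N11, N12, N13, N14, N15]

namespace NPM

section Basics

variable {α : Type*} [DecidableEq α]

theorem mem_verts {K : Complex α} {v : α} : v ∈ verts K ↔ ∃ σ ∈ K, v ∈ σ := by
  simp [verts, Finset.mem_sup]

theorem mem_facets {α : Type*} {K : Complex α} {d : ℕ} {σ : Finset α} :
    σ ∈ facets K d ↔ σ ∈ K ∧ σ.card = d + 1 := by
  simp [facets]

theorem mem_link {K : Complex α} {σ τ : Finset α} :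
    τ ∈ link K σ ↔ τ ∈ K ∧ Disjoint τ σ ∧ σ ∪ τ ∈ K := by
  simp [link]

theorem mem_genCx {F : Finset (Finset α)} {σ : Finset α} :
    σ ∈ genCx F ↔ σ.Nonempty ∧ ∃ τ ∈ F, σ ⊆ τ := by
  simp only [genCx, Finset.mem_biUnion, Finset.mem_filter, Finset.mem_powerset]
  exact ⟨fun ⟨τ, h, h', hn⟩ => ⟨hn, τ, h, h'⟩, fun ⟨hn, τ, h, h'⟩ => ⟨τ, h, h', hn⟩⟩

theorem isComplex_genCx {F : Finset (Finset α)} (hF : ∃ σ ∈ F, σ.Nonempty) :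
    IsComplex (genCx F) := by
  obtain ⟨σ, hσ, hn⟩ := hF
  refine ⟨⟨σ, mem_genCx.2 ⟨hn, σ, hσ, subset_rfl⟩⟩, fun τ hτ => (mem_genCx.1 hτ).1,
    fun τ hτ ρ hρ hn => ?_⟩
  obtain ⟨-, μ, hμ, h⟩ := mem_genCx.1 hτ
  exact mem_genCx.2 ⟨hn, μ, hμ, hρ.trans h⟩

theorem facets_genCx {F : Finset (Finset α)} {d : ℕ} (hF : ∀ σ ∈ F, σ.card = d + 1) :
    facets (genCx F) d = F := by
  ext σ
  rw [mem_facets, mem_genCx]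
  constructor
  · rintro ⟨⟨-, τ, hτ, h⟩, hc⟩
    rwa [Finset.eq_of_subset_of_card_le h (by rw [hF τ hτ, hc])]
  · intro h
    exact ⟨⟨Finset.card_pos.1 (by rw [hF σ h]; omega), σ, h, subset_rfl⟩, hF σ h⟩

/-- A bistellar move on a face of a complex given by its facets. -/
theorem kappa_genCx {F : Finset (Finset α)} {d : ℕ} {A : Finset α} (hA : A.Nonempty)
    (hF : ∀ σ ∈ F, σ.card = d + 1) (hAF : ∃ σ ∈ F, A ⊆ σ) :
    kappa d (genCx F) A = genCx (F.filter (fun σ => ¬ A ⊆ σ) ∪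
      A.image fun v => ((F.filter fun σ => A ⊆ σ).sup id).erase v) := by
  have h : verts (link (genCx F) A) ∪ A = (F.filter fun σ => A ⊆ σ).sup id := by
    ext v
    simp only [Finset.mem_union, mem_verts, mem_link, mem_genCx, Finset.mem_sup,
      Finset.mem_filter, id]
    constructor
    · rintro (⟨σ, ⟨-, -, -, τ, hτ, h⟩, hv⟩ | hv)
      · exact ⟨τ, ⟨hτ, Finset.union_subset_left h⟩, h (Finset.mem_union_right _ hv)⟩
      · obtain ⟨σ, hσ, h⟩ := hAF
        exact ⟨σ, ⟨hσ, h⟩, h hv⟩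
    · rintro ⟨σ, ⟨hσ, h⟩, hv⟩
      by_cases hvA : v ∈ A
      · exact Or.inr hvA
      · refine Or.inl ⟨{v}, ⟨⟨by simp, σ, hσ, by simpa⟩, by simpa, hA.inl, σ, hσ, ?_⟩, by simp⟩
        exact Finset.union_subset h (by simpa)
  rw [kappa, h, facets_genCx hF]

end Basics

/-- The subset of `{1, …, 8}` whose elements are the binary digits of `c`. -/
def dec (c : ℕ) : Finset ℕ := (Finset.Icc 1 8).filter fun v => c.testBit v = true

/-- The family of sets encoded by a list of numbers. -/
def faces (C : List ℕ) : Finset (Finset ℕ) := (C.map dec).toFinset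

theorem mem_dec {c v : ℕ} : v ∈ dec c ↔ v ∈ Finset.Icc 1 8 ∧ c.testBit v = true := by
  simp [dec]

theorem mem_faces {C : List ℕ} {σ : Finset ℕ} : σ ∈ faces C ↔ ∃ c ∈ C, dec c = σ := by
  simp [faces]

theorem testBit_510 {v : ℕ} : Nat.testBit 510 v = true ↔ v ∈ Finset.Icc 1 8 := by
  by_cases h : v < 9
  · interval_cases v <;> decide
  · rw [Nat.testBit_lt_two_pow (lt_of_lt_of_le (by norm_num : 510 < 2 ^ 9)
      (Nat.pow_le_pow_right (by norm_num) (by omega)))]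
    simp; omega

section Checker

/-- One pass of merging the sets in `F` that meet `S` into `S`. -/
def grow (F : List ℕ) (S : ℕ) : ℕ := F.foldl (fun S c => bif (c &&& S) == 0 then S else S ||| c) S

/-- The link of `{u, v}` in the complex with facets `C` is nonempty and connected. -/
def conn (C : List ℕ) (u v : ℕ) : Bool :=
  match (C.filter fun c => c.testBit u && c.testBit v).map fun c => c ^^^ (2 ^ u ||| 2 ^ v) with
  | [] => false
  | c :: F => F.all fun d => d &&& grow F (grow F (grow F (grow F c))) == d

/-- The list `C` encodes the facets of a neighbourly normal 3-pseudomanifold on `{1, …, 8}`. -/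
def good (C : List ℕ) : Bool :=
  decide (C.map dec).Nodup && C.all (fun c => (c &&& 510 == c) && decide ((dec c).card = 4) &&
    (List.range 9).all fun x => !c.testBit x || C.countP (fun d => (c &&& d) ||| 2 ^ x == c) == 2) &&
    (List.range' 1 8).all fun u => (List.range' 1 8).all fun v => conn C u v

theorem exists_testBit_of_and_eq {a b : ℕ} (h : (a &&& b == 0) = false) :
    ∃ i, a.testBit i = true ∧ b.testBit i = true := by
  obtain ⟨i, hi⟩ := Nat.exists_testBit_of_ne_zero (by simpa using h : a &&& b ≠ 0)
  exact ⟨i, by simpa [Nat.testBit_and] using hi⟩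

theorem grow_related {R : ℕ → ℕ → Prop}
    (trans : ∀ {a b c}, R a b → R b c → R a c) (F : List ℕ)
    (hF : ∀ c ∈ F, ∀ a b, c.testBit a = true → c.testBit b = true → R a b) (S : ℕ)
    (hS : ∀ a b, S.testBit a = true → S.testBit b = true → R a b) (a b : ℕ)
    (ha : (grow F S).testBit a = true) (hb : (grow F S).testBit b = true) : R a b := by
  induction F generalizing S with
  | nil => exact hS a b ha hb
  | cons c F ih =>
    simp only [grow, List.foldl_cons] at ha hb
    refine ih (fun c hc => hF c (by simp [hc])) _ ?_ ha hb
    have hc := hF c (by simp)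
    cases h : (c &&& S == 0) with
    | true => simpa using hS
    | false =>
      obtain ⟨i, h1, h2⟩ := exists_testBit_of_and_eq h
      simp only [cond_false, Nat.testBit_or, Bool.or_eq_true]
      rintro a b (ha | ha) (hb | hb)
      · exact hS a b ha hb
      · exact trans (hS a i ha h2) (hc i b h1 hb)
      · exact trans (hc a i ha h1) (hS i b h2 hb)
      · exact hc a b ha hb

theorem mem_dec_of_and {c v : ℕ} (hc : c &&& 510 = c) : v ∈ dec c ↔ c.testBit v = true := by
  rw [mem_dec, and_iff_right_iff_imp]
  intro h
  rw [← hc, Nat.testBit_and, Bool.and_eq_true] at h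
  exact testBit_510.1 h.2

theorem and_or_two_pow_eq_iff {c d x : ℕ} (hc : c &&& 510 = c) (hx : c.testBit x = true) :
    (c &&& d) ||| 2 ^ x = c ↔ (dec c).erase x ⊆ dec d := by
  constructor
  · intro h v hv
    rw [Finset.mem_erase, mem_dec] at hv
    have := congrArg (fun n => n.testBit v) h
    simp only [Nat.testBit_or, Nat.testBit_and, Nat.testBit_two_pow, hv.2.2] at this
    simp only [Bool.true_and, Bool.or_eq_true, decide_eq_true_eq] at this
    exact mem_dec.2 ⟨hv.2.1, this.resolve_right fun e => hv.1 e.symm⟩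
  · intro h
    refine Nat.eq_of_testBit_eq fun v => ?_
    simp only [Nat.testBit_or, Nat.testBit_and, Nat.testBit_two_pow]
    rcases eq_or_ne x v with rfl | hne
    · simp [hx]
    · cases hv : c.testBit v with
      | false => simp [hne]
      | true =>
        have := h (Finset.mem_erase.2 ⟨hne.symm, (mem_dec_of_and hc).2 hv⟩)
        simp [(mem_dec.1 this).2]

theorem good_iff {C : List ℕ} : good C = true ↔ (C.map dec).Nodup ∧
    (∀ c ∈ C, c &&& 510 = c ∧ (dec c).card = 4 ∧ ∀ x < 9, c.testBit x = true →
      C.countP (fun d => (c &&& d) ||| 2 ^ x == c) = 2) ∧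
    ∀ u ∈ Finset.Icc 1 8, ∀ v ∈ Finset.Icc 1 8, conn C u v = true := by
  have (i : ℕ) : 1 ≤ i ∧ i < 9 ↔ 1 ≤ i ∧ i ≤ 8 := by omega
  simp [good, and_assoc, imp_iff_not_or, this]

variable {C : List ℕ}

theorem conn_related {u v : ℕ} (h : conn C u v = true) {R : ℕ → ℕ → Prop}
    (trans : ∀ {a b c}, R a b → R b c → R a c)
    (hR : ∀ c ∈ C, c.testBit u = true → c.testBit v = true → ∀ a b, a ≠ u → a ≠ v → b ≠ u → b ≠ v →
      c.testBit a = true → c.testBit b = true → R a b) :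
    (∃ c ∈ C, c.testBit u = true ∧ c.testBit v = true) ∧
    ∀ c ∈ C, c.testBit u = true → c.testBit v = true → ∀ d ∈ C, d.testBit u = true →
      d.testBit v = true → ∀ a b, a ≠ u → a ≠ v → b ≠ u → b ≠ v →
      c.testBit a = true → d.testBit b = true → R a b := by
  have key (c a : ℕ) (hu : c.testBit u = true) (hv : c.testBit v = true) :
      (c ^^^ (2 ^ u ||| 2 ^ v)).testBit a = true ↔ c.testBit a = true ∧ a ≠ u ∧ a ≠ v := by
    simp only [Nat.testBit_xor, Nat.testBit_or, Nat.testBit_two_pow]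
    rcases eq_or_ne u a with rfl | h1
    · simp [hu]
    · rcases eq_or_ne v a with rfl | h2
      · simp [hv]
      · simp [h1, h2, h1.symm, h2.symm]
  have mem (e : ℕ) : e ∈ ((C.filter fun c => c.testBit u && c.testBit v).map
      fun c => c ^^^ (2 ^ u ||| 2 ^ v)) ↔
      ∃ c ∈ C, c.testBit u = true ∧ c.testBit v = true ∧ c ^^^ (2 ^ u ||| 2 ^ v) = e := by
    simp [and_assoc]
  unfold conn at h
  revert h mem
  generalize ((C.filter fun c => c.testBit u && c.testBit v).map
    fun c => c ^^^ (2 ^ u ||| 2 ^ v)) = L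
  cases L with
  | nil => simp
  | cons e F =>
    intro h mem
    simp only [List.all_eq_true, beq_iff_eq] at h
    have hF : ∀ e' ∈ e :: F, ∀ a b, e'.testBit a = true → e'.testBit b = true → R a b := by
      intro e' he' a b ha hb
      obtain ⟨c, hc, hu, hv, rfl⟩ := (mem e').1 he'
      obtain ⟨h1, h2, h3⟩ := (key c a hu hv).1 ha
      obtain ⟨h4, h5, h6⟩ := (key c b hu hv).1 hb
      exact hR c hc hu hv a b h2 h3 h5 h6 h1 h4
    have hF' := fun c hc => hF c (List.mem_cons_of_mem _ hc)
    have step := grow_related (R := R) trans F hF'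
    have fin := step _ (step _ (step _ (step _ (hF e (by simp)))))
    have sub : ∀ S a, S.testBit a = true → (grow F S).testBit a = true := by
      intro S a ha
      clear * - ha
      induction F generalizing S with
      | nil => exact ha
      | cons c F ih =>
        simp only [grow, List.foldl_cons]
        refine ih _ ?_
        cases (c &&& S == 0) <;> simp [ha]
    have all : ∀ e' ∈ e :: F, ∀ a, e'.testBit a = true →
        (grow F (grow F (grow F (grow F e)))).testBit a = true := by
      intro e' he' a ha
      rcases List.mem_cons.1 he' with rfl | he'
      · exact sub _ _ (sub _ _ (sub _ _ (sub _ _ ha)))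
      · rw [← h e' he', Nat.testBit_and, Bool.and_eq_true] at ha
        exact ha.2
    constructor
    · obtain ⟨c, hc, hu, hv, -⟩ := (mem e).1 (by simp)
      exact ⟨c, hc, hu, hv⟩
    · intro c hc hu hv d hd hu' hv' a b h1 h2 h3 h4 ha hb
      exact fin a b (all _ ((mem _).2 ⟨c, hc, hu, hv, rfl⟩) _ ((key c a hu hv).2 ⟨ha, h1, h2⟩))
        (all _ ((mem _).2 ⟨d, hd, hu', hv', rfl⟩) _ ((key d b hu' hv').2 ⟨hb, h3, h4⟩))

theorem facets_of_good (h : good C = true) : facets (genCx (faces C)) 3 = faces C :=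
  facets_genCx fun σ hσ => by
    obtain ⟨c, hc, rfl⟩ := mem_faces.1 hσ
    exact ((good_iff.1 h).2.1 c hc).2.1

theorem verts_of_good (h : good C = true) : verts (genCx (faces C)) = Finset.Icc 1 8 := by
  ext v
  simp only [mem_verts, mem_genCx]
  constructor
  · rintro ⟨σ, ⟨-, τ, hτ, hs⟩, hv⟩
    obtain ⟨c, hc, rfl⟩ := mem_faces.1 hτ
    exact (mem_dec.1 (hs hv)).1
  · intro hv
    obtain ⟨⟨c, hc, hcv, -⟩, -⟩ := conn_related ((good_iff.1 h).2.2 v hv v hv) (R := fun _ _ => True)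
      (fun _ _ => trivial) (by simp)
    exact ⟨{v}, ⟨by simp, dec c, mem_faces.2 ⟨c, hc, rfl⟩, by simp [mem_dec, hcv, -Finset.mem_Icc, hv]⟩,
      by simp⟩

theorem neighbourly_of_good (h : good C = true) : Neighbourly (genCx (faces C)) := by
  intro u hu v hv hne
  rw [verts_of_good h] at hu hv
  obtain ⟨⟨c, hc, hcu, hcv⟩, -⟩ := conn_related ((good_iff.1 h).2.2 u hu v hv) (R := fun _ _ => True)
    (fun _ _ => trivial) (by simp)
  refine mem_genCx.2 ⟨by simp, dec c, mem_faces.2 ⟨c, hc, rfl⟩, ?_⟩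
  intro w hw
  simp only [Finset.mem_insert, Finset.mem_singleton] at hw
  rcases hw with rfl | rfl
  · exact mem_dec.2 ⟨hu, hcu⟩
  · exact mem_dec.2 ⟨hv, hcv⟩

theorem conn_of_neighbourly {α : Type*} [DecidableEq α] {K : Complex α} (hK : Neighbourly K)
    (hn : (verts K).Nonempty) : Conn K := by
  refine ⟨hn, fun u hu v hv => ?_⟩
  rcases eq_or_ne u v with rfl | hne
  · exact .refl
  · exact .single ⟨hne, hK u hu v hv hne⟩

theorem weakPM_of_good (h : good C = true) : WeakPM (genCx (faces C)) 3 := by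
  obtain ⟨hnd, hC, hconn⟩ := good_iff.1 h
  have hne : (Finset.Icc 1 8).Nonempty := ⟨1, by simp⟩
  refine ⟨isComplex_genCx ?_, ?_, ?_⟩
  · rw [← verts_of_good h] at hne
    obtain ⟨v, hv⟩ := hne
    obtain ⟨σ, hσ, -⟩ := mem_verts.1 hv
    obtain ⟨hs, τ, hτ, hst⟩ := mem_genCx.1 hσ
    exact ⟨τ, hτ, hs.mono hst⟩
  · intro σ hσ
    obtain ⟨hs, τ, hτ, hst⟩ := mem_genCx.1 hσ
    obtain ⟨c, hc, rfl⟩ := mem_faces.1 hτ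
    exact ⟨dec c, mem_genCx.2 ⟨hs.mono hst, _, hτ, subset_rfl⟩, hst, (hC c hc).2.1⟩
  · intro σ hσ h3
    obtain ⟨-, τ, hτ, hst⟩ := mem_genCx.1 hσ
    obtain ⟨c, hc, rfl⟩ := mem_faces.1 hτ
    obtain ⟨hc1, hc2, hc3⟩ := hC c hc
    obtain ⟨x, hx⟩ : ∃ x, dec c \ σ = {x} :=
      Finset.card_eq_one.1 (by rw [Finset.card_sdiff_of_subset hst]; omega)
    have hxc : x ∈ dec c := (Finset.mem_sdiff.1 (hx ▸ Finset.mem_singleton_self x)).1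
    have hσ : σ = (dec c).erase x := by
      rw [← Finset.sdiff_singleton_eq_erase, ← hx, Finset.sdiff_sdiff_eq_self hst]
    have hxb := (mem_dec.1 hxc).2
    rw [← hc3 x (by have := (mem_dec.1 hxc).1; simp at this; omega) hxb]
    have : ((genCx (faces C)).filter fun τ => σ ⊆ τ ∧ τ.card = 3 + 1) =
        (faces C).filter fun τ => σ ⊆ τ := by
      conv_rhs => rw [← facets_of_good h]
      ext τ
      simp only [Finset.mem_filter, facets]
      tauto
    have hl : ((faces C).filter fun τ => σ ⊆ τ) =
        ((C.map dec).filter fun τ => decide (σ ⊆ τ)).toFinset := by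
      ext τ
      simp [faces]
    rw [this, hl, List.toFinset_card_of_nodup (hnd.filter _), ← List.countP_eq_length_filter,
      List.countP_map]
    congr 1
    funext d
    rw [Bool.eq_iff_iff]
    simp [hσ, and_or_two_pow_eq_iff hc1 hxb]

theorem normalPM_of_good (h : good C = true) : NormalPM (genCx (faces C)) 3 := by
  obtain ⟨hnd, hC, hconn⟩ := good_iff.1 h
  refine ⟨weakPM_of_good h, conn_of_neighbourly (neighbourly_of_good h)
    (by rw [verts_of_good h]; exact ⟨1, by simp⟩), fun σ hσ h2 => ?_⟩
  obtain ⟨hs, τ, hτ, hst⟩ := mem_genCx.1 hσ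
  obtain ⟨c, hc, rfl⟩ := mem_faces.1 hτ
  obtain ⟨u, v, rfl⟩ : ∃ u v, σ = {u, v} := by
    have h0 := hs.card_pos
    obtain h1 | h1 : σ.card = 1 ∨ σ.card = 2 := by omega
    · obtain ⟨u, rfl⟩ := Finset.card_eq_one.1 h1
      exact ⟨u, u, by simp⟩
    · obtain ⟨u, v, -, rfl⟩ := Finset.card_eq_two.1 h1
      exact ⟨u, v, rfl⟩
  have hu := (mem_dec.1 (hst (show u ∈ ({u, v} : Finset ℕ) by simp))).1
  have hv := (mem_dec.1 (hst (show v ∈ ({u, v} : Finset ℕ) by simp))).1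
  have mem (ρ : Finset ℕ) : ρ ∈ link (genCx (faces C)) {u, v} ↔ ρ.Nonempty ∧ u ∉ ρ ∧ v ∉ ρ ∧
      ∃ c ∈ C, c.testBit u = true ∧ c.testBit v = true ∧ ∀ a ∈ ρ, c.testBit a = true := by
    have e : Disjoint ρ {u, v} ↔ u ∉ ρ ∧ v ∉ ρ := by
      simp [Finset.disjoint_insert_right]
    have e' : (∃ τ ∈ faces C, {u, v} ∪ ρ ⊆ τ) ↔
        ∃ c ∈ C, c.testBit u = true ∧ c.testBit v = true ∧ ∀ a ∈ ρ, c.testBit a = true := by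
      constructor
      · rintro ⟨τ, hτ, hs⟩
        obtain ⟨c, hc, rfl⟩ := mem_faces.1 hτ
        exact ⟨c, hc, (mem_dec.1 (hs (by simp))).2, (mem_dec.1 (hs (by simp))).2,
          fun a ha => (mem_dec.1 (hs (by simp [ha]))).2⟩
      · rintro ⟨c, hc, h1, h2, h3⟩
        refine ⟨dec c, mem_faces.2 ⟨c, hc, rfl⟩, fun a ha => (mem_dec_of_and (hC c hc).1).2 ?_⟩
        simp only [Finset.mem_union, Finset.mem_insert, Finset.mem_singleton] at ha
        rcases ha with (rfl | rfl) | ha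
        exacts [h1, h2, h3 a ha]
    rw [mem_link, mem_genCx, mem_genCx, e, e']
    constructor
    · rintro ⟨⟨h1, -⟩, ⟨h2, h3⟩, -, h4⟩
      exact ⟨h1, h2, h3, h4⟩
    · rintro ⟨h1, h2, h3, h4⟩
      obtain ⟨τ, hτ, hs⟩ := e'.2 h4
      exact ⟨⟨h1, τ, hτ, (Finset.subset_union_right).trans hs⟩, ⟨h2, h3⟩, by simp, h4⟩
  have memv (w : ℕ) : w ∈ verts (link (genCx (faces C)) {u, v}) ↔ w ≠ u ∧ w ≠ v ∧
      ∃ c ∈ C, c.testBit u = true ∧ c.testBit v = true ∧ c.testBit w = true := by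
    simp only [mem_verts, mem]
    constructor
    · rintro ⟨ρ, ⟨-, h1, h2, c, hc, h3, h4, h5⟩, hw⟩
      exact ⟨fun e => h1 (e ▸ hw), fun e => h2 (e ▸ hw), c, hc, h3, h4, h5 w hw⟩
    · rintro ⟨h1, h2, c, hc, h3, h4, h5⟩
      exact ⟨{w}, ⟨by simp, by simpa using h1.symm, by simpa using h2.symm, c, hc, h3, h4,
        by simpa using h5⟩, by simp⟩
  obtain ⟨⟨d, hd, hdu, hdv⟩, hR⟩ := conn_related (hconn u hu v hv)
    (R := Relation.ReflTransGen
      (fun a b => a ≠ b ∧ ({a, b} : Finset ℕ) ∈ link (genCx (faces C)) {u, v}))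
    (fun h h' => h.trans h')
    (by
      intro c hc hcu hcv a b h1 h2 h3 h4 ha hb
      rcases eq_or_ne a b with rfl | hne
      · exact .refl
      · exact .single ⟨hne, (mem _).2 ⟨by simp, by simp [h1.symm, h3.symm], by simp [h2.symm, h4.symm],
          c, hc, hcu, hcv, by simp [ha, hb]⟩⟩)
  constructor
  · have : (dec d \ {u, v}).Nonempty := by
      rw [← Finset.card_pos]
      have := Finset.le_card_sdiff {u, v} (dec d)
      rw [(hC d hd).2.1] at this
      have : ({u, v} : Finset ℕ).card ≤ 2 := Finset.card_le_two
      omega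
    obtain ⟨w, hw⟩ := this
    simp only [Finset.mem_sdiff, Finset.mem_insert, Finset.mem_singleton, not_or] at hw
    exact ⟨w, (memv w).2 ⟨hw.2.1, hw.2.2, d, hd, hdu, hdv, (mem_dec.1 hw.1).2⟩⟩
  · intro a ha b hb
    obtain ⟨h1, h2, c, hc, h3, h4, h5⟩ := (memv a).1 ha
    obtain ⟨h1', h2', c', hc', h3', h4', h5'⟩ := (memv b).1 hb
    exact hR c hc h3 h4 c' hc' h3' h4' a b h1 h2 h1' h2' h5 h5'

end Checker

section Verifier

/-- The codes obtained from `c` by adding one element of `{1, …, 8}`. -/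
def supers (c : ℕ) : List ℕ :=
  ((List.range' 1 8).filter fun x => !c.testBit x).map fun x => c ||| 2 ^ x

/-- The number whose binary digits are the elements of the list. -/
def bits (l : List ℕ) : ℕ := l.foldr (fun v s => 2 ^ v ||| s) 0

/-- The code of the image of the set with code `m` under `i ↦ π.getD (i - 1) 0`. -/
def renumber (π : List ℕ) (m : ℕ) : ℕ :=
  bits (((List.range' 1 8).filter fun i => m.testBit i).map fun i => π.getD (i - 1) 0)

/-- Steps of a derivation about the set of facets of a neighbourly normal 3-pseudomanifold on
`{1, …, 8}`. -/
inductive Op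
  /-- The triangle `t` lies in no facet or in exactly two facets. -/
  | tri (t : ℕ)
  /-- The edge `uv` lies in a facet. -/
  | edge (u v : ℕ)
  /-- If `uvxy`, `uvyz` and `uvxz` are facets, then no other facet contains `uv`. -/
  | ring (u v x y z : ℕ)
  /-- Distinguish whether `m` is a facet; the case in which it is comes first. -/
  | split (m : ℕ)
  /-- The facets contain a copy of the `j`-th known pattern. -/
  | known (j : ℕ) (π : List ℕ)

/-- Continue with the first remaining case, if any. -/
def resume (r : ℕ → ℕ → List (ℕ × ℕ) → Bool) : List (ℕ × ℕ) → Bool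
  | [] => true
  | (a, b) :: st => r a b st

/-- Run a derivation. The sets with codes in `a` are facets, those with codes in `b` are not,
and `st` is the stack of the remaining cases. -/
def run (db : List (List ℕ)) : List Op → ℕ → ℕ → List (ℕ × ℕ) → Bool
  | [], _, _, _ => false
  | op :: ops, a, b, st =>
    match op with
    | .tri t =>
      match (supers t).filter a.testBit, (supers t).filter fun m => !a.testBit m && !b.testBit m with
      | [], [m] => run db ops a (2 ^ m ||| b) st
      | [_], [] => resume (run db ops) st
      | [_], [m] => run db ops (2 ^ m ||| a) b st
      | [_, _], u => run db ops a (bits u ||| b) st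
      | _ :: _ :: _ :: _, _ => resume (run db ops) st
      | _, _ => false
    | .edge u v =>
      (u != v && 1 ≤ u && u ≤ 8 && 1 ≤ v && v ≤ 8 &&
        ((supers (bits [u, v])).flatMap supers).all b.testBit) && resume (run db ops) st
    | .ring u v x y z =>
      ([u, v, x, y, z].all fun i => 1 ≤ i && i ≤ 8) && a.testBit (bits [u, v, x, y]) &&
        a.testBit (bits [u, v, y, z]) && a.testBit (bits [u, v, x, z]) &&
        let l := ((List.range' 1 8).filter fun w => !(bits [u, v, x, y, z]).testBit w).flatMap
          fun w => supers (bits [u, v, w])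
        bif l.any a.testBit then resume (run db ops) st else run db ops a (bits l ||| b) st
    | .split m => run db ops (2 ^ m ||| a) b ((a, 2 ^ m ||| b) :: st)
    | .known j π =>
      (decide ((List.range' 1 8).map fun i => π.getD (i - 1) 0).Nodup &&
        ((List.range' 1 8).all fun i => 1 ≤ π.getD (i - 1) 0 && π.getD (i - 1) 0 ≤ 8) &&
        (match db[j]? with
        | none => false
        | some A => A.all fun m => a.testBit (renumber π m))) && resume (run db ops) st

/-- Verify a list of patterns with their derivations; a pattern may be used once verified. -/
def verify : List (List ℕ) → List (List ℕ × List Op) → Bool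
  | _, [] => true
  | db, (A, ops) :: rest => run db ops (bits A) 0 [] && verify (db ++ [A]) rest

end Verifier

section Geometry

variable {α : Type*} [DecidableEq α] {K : Complex α}

theorem WeakPM.two_facets (hK : WeakPM K 3) {t : Finset α} (ht : t.card = 3) {σ : Finset α}
    (hσ : σ ∈ facets K 3) (hs : t ⊆ σ) :
    ∃ σ₁ σ₂, σ₁ ≠ σ₂ ∧ ∀ τ, τ ∈ facets K 3 ∧ t ⊆ τ ↔ τ = σ₁ ∨ τ = σ₂ := by
  have htK : t ∈ K := hK.1.2.2 σ (mem_facets.1 hσ).1 t hs (Finset.card_pos.1 (by omega))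
  obtain ⟨σ₁, σ₂, hne, h⟩ := Finset.card_eq_two.1 (hK.2.2 t htK ht)
  refine ⟨σ₁, σ₂, hne, fun τ => ?_⟩
  have := congrArg (τ ∈ ·) h
  simp only [Finset.mem_filter, Finset.mem_insert, Finset.mem_singleton, eq_iff_iff] at this
  rw [mem_facets, ← this]
  tauto

theorem WeakPM.exists_ne_facet (hK : WeakPM K 3) {t : Finset α} (ht : t.card = 3) {σ : Finset α}
    (hσ : σ ∈ facets K 3) (hs : t ⊆ σ) : ∃ τ ∈ facets K 3, t ⊆ τ ∧ τ ≠ σ := by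
  obtain ⟨σ₁, σ₂, hne, h⟩ := hK.two_facets ht hσ hs
  rcases (h σ).1 ⟨hσ, hs⟩ with rfl | rfl
  · exact ⟨σ₂, ((h _).2 (.inr rfl)).1, ((h _).2 (.inr rfl)).2, hne.symm⟩
  · exact ⟨σ₁, ((h _).2 (.inl rfl)).1, ((h _).2 (.inl rfl)).2, hne⟩

theorem WeakPM.eq_or_eq (hK : WeakPM K 3) {t : Finset α} (ht : t.card = 3) {σ τ ρ : Finset α}
    (hσ : σ ∈ facets K 3) (hτ : τ ∈ facets K 3) (hρ : ρ ∈ facets K 3) (hne : σ ≠ τ)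
    (hσt : t ⊆ σ) (hτt : t ⊆ τ) (hρt : t ⊆ ρ) : ρ = σ ∨ ρ = τ := by
  obtain ⟨σ₁, σ₂, -, h⟩ := hK.two_facets ht hσ hσt
  rcases (h σ).1 ⟨hσ, hσt⟩ with rfl | rfl <;> rcases (h τ).1 ⟨hτ, hτt⟩ with rfl | rfl <;>
    rcases (h ρ).1 ⟨hρ, hρt⟩ with rfl | rfl <;> simp_all

/-- A set of facets around an edge in which every triangle at the edge lies in two members or
none contains all the facets at the edge. -/
theorem NormalPM.star_subset (hK : NormalPM K 3) {e : Finset α} (he : e.card = 2)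
    {M : Set (Finset α)} (hM : ∀ σ ∈ M, σ ∈ facets K 3) (hne : ∃ σ ∈ M, e ⊆ σ)
    (hclosed : ∀ t, t.card = 3 → e ⊆ t → ∀ σ ∈ M, t ⊆ σ → ∃ τ ∈ M, t ⊆ τ ∧ τ ≠ σ)
    {σ : Finset α} (hσ : σ ∈ facets K 3) (hes : e ⊆ σ) : σ ∈ M := by
  have hW := hK.1
  have face {τ ρ : Finset α} (hτ : τ ∈ K) (h : ρ ⊆ τ) (hn : ρ.Nonempty) : ρ ∈ K :=
    hW.1.2.2 τ hτ ρ h hn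
  have hcl : ∀ t, t.card = 3 → e ⊆ t → (∃ σ ∈ M, t ⊆ σ) → ∀ ρ ∈ facets K 3, t ⊆ ρ → ρ ∈ M := by
    rintro t ht het ⟨σ, hσ, hts⟩ ρ hρ htρ
    obtain ⟨τ, hτ, htt, hne⟩ := hclosed t ht het σ hσ hts
    rcases hW.eq_or_eq ht (hM σ hσ) (hM τ hτ) hρ hne.symm hts htt htρ with rfl | rfl <;> assumption
  obtain ⟨σ₀, hσ₀, hes₀⟩ := hne
  have mem_verts_link {τ : Finset α} (hτ : τ ∈ facets K 3) (h : e ⊆ τ) {w : α} (hw : w ∈ τ)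
      (hwe : w ∉ e) : w ∈ verts (link K e) := by
    refine mem_verts.2 ⟨{w}, mem_link.2 ⟨?_, by simpa, ?_⟩, by simp⟩
    · exact face (mem_facets.1 hτ).1 (by simpa) (by simp)
    · exact face (mem_facets.1 hτ).1 (Finset.union_subset h (by simpa)) (by simp)
  have exists_vertex {τ : Finset α} (hτ : τ ∈ facets K 3) (h : e ⊆ τ) : ∃ w ∈ τ, w ∉ e := by
    refine Finset.not_subset.1 fun hle => ?_
    have := Finset.card_le_card hle
    have := (mem_facets.1 hτ).2
    omega
  obtain ⟨w₀, hw₀, hwe₀⟩ := exists_vertex (hM _ hσ₀) hes₀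
  obtain ⟨w, hw, hwe⟩ := exists_vertex hσ hes
  have heK : e ∈ K := face (mem_facets.1 hσ).1 hes (Finset.card_pos.1 (by omega))
  have path := (hK.2.2 e heK (by omega)).2 w₀ (mem_verts_link (hM _ hσ₀) hes₀ hw₀ hwe₀) w
    (mem_verts_link hσ hes hw hwe)
  have reach : w ∉ e ∧ ∃ τ ∈ M, insert w e ⊆ τ := by
    clear hw hwe
    induction path with
    | refl => exact ⟨hwe₀, σ₀, hσ₀, Finset.insert_subset hw₀ hes₀⟩
    | @tail a b _ hab ih =>
      obtain ⟨hae, τ, hτ, hs⟩ := ih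
      obtain ⟨-, hd, hK'⟩ := mem_link.1 hab.2
      simp only [Finset.disjoint_insert_left, Finset.disjoint_singleton_left] at hd
      have hc : (e ∪ {a, b}).card = 3 + 1 := by
        rw [Finset.card_union_of_disjoint (by simp [Finset.disjoint_insert_right, hd]),
          Finset.card_pair hab.1, he]
      refine ⟨hd.2, e ∪ {a, b}, hcl (insert a e) (by rw [Finset.card_insert_of_notMem hae, he])
        (Finset.subset_insert _ _) ⟨τ, hτ, hs⟩ _ (mem_facets.2 ⟨hK', hc⟩) ?_, ?_⟩ <;>
      · intro x hx
        simp only [Finset.mem_insert, Finset.mem_union, Finset.mem_singleton] at hx ⊢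
        tauto
  exact hcl (insert w e) (by rw [Finset.card_insert_of_notMem hwe, he])
    (Finset.subset_insert _ _) reach.2 σ hσ (Finset.insert_subset hw hes)

theorem NormalPM.ring (hK : NormalPM K 3) {u v x y z : α} (h₁ : {u, v, x, y} ∈ facets K 3)
    (h₂ : {u, v, y, z} ∈ facets K 3) (h₃ : {u, v, x, z} ∈ facets K 3) {σ : Finset α}
    (hσ : σ ∈ facets K 3) (hu : u ∈ σ) (hv : v ∈ σ) : σ ⊆ {u, v, x, y, z} := by
  have distinct {a b c d : α} (h : ({a, b, c, d} : Finset α) ∈ facets K 3) :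
      (a ≠ b ∧ a ≠ c ∧ a ≠ d) ∧ (b ≠ c ∧ b ≠ d) ∧ c ≠ d := by
    have h := (mem_facets.1 h).2
    refine ⟨⟨?_, ?_, ?_⟩, ⟨?_, ?_⟩, ?_⟩ <;> rintro rfl <;> revert h <;>
    · simp only [Finset.mem_insert, Finset.mem_singleton, true_or, or_true, Finset.insert_eq_of_mem]
      intro h
      have := h ▸ Finset.card_le_three
      omega
  obtain ⟨⟨huv, hux, huy⟩, ⟨hvx, hvy⟩, hxy⟩ := distinct h₁
  obtain ⟨⟨-, -, huz⟩, ⟨-, hvz⟩, hyz⟩ := distinct h₂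
  obtain ⟨-, -, hxz⟩ := distinct h₃
  have hmem := hK.star_subset (e := {u, v}) (Finset.card_pair huv)
    (M := {{u, v, x, y}, {u, v, y, z}, {u, v, x, z}}) (by simp [h₁, h₂, h₃])
    ⟨_, by simp; exact .inl rfl, fun a => by simp; tauto⟩ ?_ hσ
    (by simp [Finset.insert_subset_iff, hu, hv])
  · simp only [Set.mem_insert_iff, Set.mem_singleton_iff] at hmem
    rcases hmem with rfl | rfl | rfl <;> intro a <;> simp <;> tauto
  · intro t ht het τ hτ hts
    obtain ⟨w, hw⟩ : ∃ w, t \ {u, v} = {w} := Finset.card_eq_one.1 (by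
      rw [Finset.card_sdiff_of_subset het, Finset.card_pair huv, ht])
    have ht' : t = {u, v, w} := by
      rw [← Finset.union_sdiff_of_subset het, hw]
      ext
      simp
    have hwm : w ∈ t \ {u, v} := by simp [hw]
    simp only [Finset.mem_sdiff, Finset.mem_insert, Finset.mem_singleton, not_or] at hwm
    subst ht'
    have hwt : w ∈ τ := hts (by simp)
    have ne {a : Finset α} (c : α) (hc : c ∈ a) (hcτ : c ∉ τ) : a ≠ τ := fun h => hcτ (h ▸ hc)
    have hx : x ∉ ({u, v, y, z} : Finset α) := by simp [hux.symm, hvx.symm, hxy, hxz]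
    have hy : y ∉ ({u, v, x, z} : Finset α) := by simp [huy.symm, hvy.symm, hxy.symm, hyz]
    have hz : z ∉ ({u, v, x, y} : Finset α) := by simp [huz.symm, hvz.symm, hxz.symm, hyz.symm]
    have sub {a b : α} (h : w = a ∨ w = b) : ({u, v, w} : Finset α) ⊆ {u, v, a, b} := by
      intro c
      simp only [Finset.mem_insert, Finset.mem_singleton]
      grind
    simp only [Set.mem_insert_iff, Set.mem_singleton_iff] at hτ
    rcases hτ with rfl | rfl | rfl <;>
      simp only [Finset.mem_insert, Finset.mem_singleton, hwm.2, false_or] at hwt <;>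
      rcases hwt with rfl | rfl
    · exact ⟨{u, v, w, z}, by simp, sub (.inl rfl), ne z (by simp) hz⟩
    · exact ⟨{u, v, w, z}, by simp, sub (.inl rfl), ne z (by simp) hz⟩
    · exact ⟨{u, v, x, w}, by simp, sub (.inr rfl), ne x (by simp) hx⟩
    · exact ⟨{u, v, x, w}, by simp, sub (.inr rfl), ne x (by simp) hx⟩
    · exact ⟨{u, v, w, y}, by simp, sub (.inl rfl), ne y (by simp) hy⟩
    · exact ⟨{u, v, y, w}, by simp, sub (.inr rfl), ne y (by simp) hy⟩

end Geometry

section Labelling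

variable {α : Type*} [DecidableEq α] {K : Complex α} {f : ℕ → α}

/-- `f` numbers the vertices of `K` by `1, …, 8`. -/
structure Labelling (K : Complex α) (f : ℕ → α) : Prop where
  injOn : Set.InjOn f (Finset.Icc 1 8 : Finset ℕ)
  image_eq : (Finset.Icc 1 8).image f = verts K

/-- The set with code `m` is a facet of `K` under the numbering `f`. -/
def Holds (K : Complex α) (f : ℕ → α) (m : ℕ) : Prop := (dec m).image f ∈ facets K 3

theorem dec_subset (m : ℕ) : dec m ⊆ Finset.Icc 1 8 := Finset.filter_subset _ _

theorem dec_or_two_pow {c x : ℕ} (hx : x ∈ Finset.Icc 1 8) :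
    dec (c ||| 2 ^ x) = insert x (dec c) := by
  ext v
  simp only [mem_dec, Nat.testBit_or, Nat.testBit_two_pow, Bool.or_eq_true, decide_eq_true_eq,
    Finset.mem_insert, eq_comm (a := x)]
  constructor
  · tauto
  · rintro (rfl | h)
    exacts [⟨hx, .inr rfl⟩, ⟨h.1, .inl h.2⟩]

theorem mem_supers {c m : ℕ} :
    m ∈ supers c ↔ ∃ x ∈ Finset.Icc 1 8, x ∉ dec c ∧ c ||| 2 ^ x = m := by
  simp only [supers, List.mem_map, List.mem_filter, List.mem_range'_1, mem_dec, Finset.mem_Icc,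
    Bool.not_eq_true']
  refine exists_congr fun x => ⟨?_, ?_⟩
  · rintro ⟨⟨h1, h2⟩, rfl⟩
    exact ⟨by omega, by simp [h2], rfl⟩
  · rintro ⟨h1, h2, rfl⟩
    exact ⟨⟨by omega, by simpa [h1] using h2⟩, rfl⟩

theorem dec_of_mem_supers {c m : ℕ} (h : m ∈ supers c) :
    ∃ x ∈ Finset.Icc 1 8, x ∉ dec c ∧ dec m = insert x (dec c) := by
  obtain ⟨x, hx, hxc, rfl⟩ := mem_supers.1 h
  exact ⟨x, hx, hxc, dec_or_two_pow hx⟩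

theorem subset_of_mem_supers {c m : ℕ} (h : m ∈ supers c) : dec c ⊆ dec m := by
  obtain ⟨x, -, -, h⟩ := dec_of_mem_supers h
  exact h ▸ Finset.subset_insert _ _

theorem card_of_mem_supers {c m : ℕ} (h : m ∈ supers c) : (dec m).card = (dec c).card + 1 := by
  obtain ⟨x, -, hx, h⟩ := dec_of_mem_supers h
  rw [h, Finset.card_insert_of_notMem hx]

theorem nodup_supers (c : ℕ) : (supers c).Nodup := by
  refine List.Nodup.map_on (fun x hx y hy h => ?_) ((List.nodup_range' (step := 1)).filter _)
  simp only [List.mem_filter, List.mem_range'_1, Bool.not_eq_true'] at hx hy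
  have := congrArg (fun n => n.testBit x) h
  simp only [Nat.testBit_or, Nat.testBit_two_pow, hx.2] at this
  exact (by simpa using this : y = x).symm

theorem bits_cons (v : ℕ) (l : List ℕ) : bits (v :: l) = 2 ^ v ||| bits l := rfl

theorem testBit_bits {l : List ℕ} {v : ℕ} : (bits l).testBit v = true ↔ v ∈ l := by
  induction l with
  | nil => simp [bits]
  | cons a l ih =>
    rw [bits_cons, Nat.testBit_or, Bool.or_eq_true, ih, Nat.testBit_two_pow]
    simp [eq_comm]

theorem dec_bits {l : List ℕ} (h : ∀ v ∈ l, v ∈ Finset.Icc 1 8) : dec (bits l) = l.toFinset := by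
  ext v
  rw [mem_dec, testBit_bits, List.mem_toFinset]
  exact ⟨fun h => h.2, fun hv => ⟨h v hv, hv⟩⟩

namespace Labelling

theorem card_image (hf : Labelling K f) (m : ℕ) : ((dec m).image f).card = (dec m).card :=
  Finset.card_image_of_injOn (hf.injOn.mono (Finset.coe_subset.2 (dec_subset m)))

theorem card_dec (hf : Labelling K f) {m : ℕ} (h : Holds K f m) : (dec m).card = 4 := by
  rw [← hf.card_image]
  exact (mem_facets.1 h).2

theorem subset_image (hf : Labelling K f) {σ : Finset α} (hσ : σ ∈ facets K 3) :
    σ ⊆ (Finset.Icc 1 8).image f := by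
  rw [hf.image_eq]
  exact fun v hv => mem_verts.2 ⟨σ, (mem_facets.1 hσ).1, hv⟩

theorem mem_dec_of_mem_image (hf : Labelling K f) {m x : ℕ} (hx : x ∈ Finset.Icc 1 8)
    (h : f x ∈ (dec m).image f) : x ∈ dec m := by
  obtain ⟨y, hy, e⟩ := Finset.mem_image.1 h
  exact hf.injOn (dec_subset m hy) hx e ▸ hy

theorem exists_super (hf : Labelling K f) {σ : Finset α} (hσ : σ ∈ facets K 3) {c : ℕ}
    (hc : (dec c).card < 4) (hs : (dec c).image f ⊆ σ) : ∃ m ∈ supers c, (dec m).image f ⊆ σ := by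
  obtain ⟨w, hw, hwc⟩ : ∃ w ∈ σ, w ∉ (dec c).image f := by
    refine Finset.not_subset.1 fun hle => ?_
    have := Finset.card_le_card hle
    rw [hf.card_image, (mem_facets.1 hσ).2] at this
    omega
  obtain ⟨x, hx, rfl⟩ := Finset.mem_image.1 (hf.subset_image hσ hw)
  have hxc : x ∉ dec c := fun h => hwc (Finset.mem_image_of_mem f h)
  refine ⟨c ||| 2 ^ x, mem_supers.2 ⟨x, hx, hxc, rfl⟩, ?_⟩
  rw [dec_or_two_pow hx, Finset.image_insert]
  exact Finset.insert_subset hw hs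

theorem holds_of_subset (hf : Labelling K f) {σ : Finset α} (hσ : σ ∈ facets K 3) {m : ℕ}
    (hm : (dec m).card = 4) (hs : (dec m).image f ⊆ σ) : (dec m).image f = σ ∧ Holds K f m := by
  have : (dec m).image f = σ := Finset.eq_of_subset_of_card_le hs
    (by rw [hf.card_image, hm, (mem_facets.1 hσ).2])
  exact ⟨this, by rwa [Holds, this]⟩

theorem exists_ne (hf : Labelling K f) (hK : WeakPM K 3) {t m : ℕ} (hm : m ∈ supers t)
    (h : Holds K f m) : ∃ m' ∈ supers t, m' ≠ m ∧ Holds K f m' := by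
  have ht : (dec t).card = 3 := by
    have := hf.card_dec h
    rw [card_of_mem_supers hm] at this
    omega
  obtain ⟨τ, hτ, hs, hne⟩ := hK.exists_ne_facet ((hf.card_image t).trans ht) h
    (Finset.image_subset_image (subset_of_mem_supers hm))
  obtain ⟨m', hm', hs'⟩ := hf.exists_super hτ (by omega) hs
  obtain ⟨h1, h2⟩ := hf.holds_of_subset hτ (by rw [card_of_mem_supers hm', ht]) hs'
  exact ⟨m', hm', fun e => hne (by rw [← h1, e]), h2⟩

theorem eq_or_eq (hf : Labelling K f) (hK : WeakPM K 3) {t m₁ m₂ m₃ : ℕ} (hm₁ : m₁ ∈ supers t)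
    (hm₂ : m₂ ∈ supers t) (hm₃ : m₃ ∈ supers t) (h₁ : Holds K f m₁) (h₂ : Holds K f m₂)
    (h₃ : Holds K f m₃) (hne : m₁ ≠ m₂) : m₃ = m₁ ∨ m₃ = m₂ := by
  have ht : (dec t).card = 3 := by
    have := hf.card_dec h₁
    rw [card_of_mem_supers hm₁] at this
    omega
  have inj {m m' : ℕ} (hm : m ∈ supers t) (hm' : m' ∈ supers t)
      (h : (dec m).image f = (dec m').image f) : m = m' := by
    obtain ⟨x, hx, hxt, rfl⟩ := mem_supers.1 hm
    obtain ⟨y, hy, hyt, rfl⟩ := mem_supers.1 hm'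
    have : x ∈ dec (t ||| 2 ^ y) := hf.mem_dec_of_mem_image hx (by
      rw [← h, dec_or_two_pow hx]
      exact Finset.mem_image_of_mem f (Finset.mem_insert_self _ _))
    rw [dec_or_two_pow hy, Finset.mem_insert] at this
    rw [this.resolve_right hxt]
  exact (hK.eq_or_eq ((hf.card_image t).trans ht) h₁ h₂ h₃ (fun h => hne (inj hm₁ hm₂ h))
    (Finset.image_subset_image (subset_of_mem_supers hm₁))
    (Finset.image_subset_image (subset_of_mem_supers hm₂))
    (Finset.image_subset_image (subset_of_mem_supers hm₃))).imp (inj hm₃ hm₁) (inj hm₃ hm₂)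

theorem exists_facet_of_edge (hf : Labelling K f) (hK : WeakPM K 3) (hN : Neighbourly K) {u v : ℕ}
    (hu : u ∈ Finset.Icc 1 8) (hv : v ∈ Finset.Icc 1 8) (hne : u ≠ v) :
    ∃ m ∈ (supers (bits [u, v])).flatMap supers, Holds K f m := by
  have hd : dec (bits [u, v]) = {u, v} := by
    rw [dec_bits (by
      simp only [List.mem_cons, List.not_mem_nil, or_false, forall_eq_or_imp, forall_eq]
      exact ⟨hu, hv⟩)]
    simp
  have mem {w : ℕ} (hw : w ∈ Finset.Icc 1 8) : f w ∈ verts K :=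
    hf.image_eq ▸ Finset.mem_image_of_mem f hw
  obtain ⟨σ, hσ, hs, hc⟩ := hK.2.1 _ (hN _ (mem hu) _ (mem hv) fun h => hne (hf.injOn hu hv h))
  have hσ := mem_facets.2 ⟨hσ, hc⟩
  have h2 : (dec (bits [u, v])).card = 2 := by rw [hd, Finset.card_pair hne]
  obtain ⟨t, ht, hts⟩ := hf.exists_super hσ (by rw [h2]; omega)
    (by simpa [hd, Finset.image_insert] using hs)
  have h3 := card_of_mem_supers ht
  obtain ⟨m, hm, hms⟩ := hf.exists_super hσ (by omega) hts
  have h4 := card_of_mem_supers hm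
  exact ⟨m, List.mem_flatMap.2 ⟨t, ht, hm⟩, (hf.holds_of_subset hσ (by omega) hms).2⟩

theorem ring (hf : Labelling K f) (hK : NormalPM K 3) {u v x y z w m : ℕ}
    (hl : ∀ i ∈ [u, v, x, y, z], i ∈ Finset.Icc 1 8) (h₁ : Holds K f (bits [u, v, x, y]))
    (h₂ : Holds K f (bits [u, v, y, z])) (h₃ : Holds K f (bits [u, v, x, z]))
    (hw : w ∈ Finset.Icc 1 8) (hw' : w ∉ [u, v, x, y, z]) (hm : m ∈ supers (bits [u, v, w])) :
    ¬ Holds K f m := by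
  intro h
  simp only [List.mem_cons, List.not_mem_nil, or_false, forall_eq_or_imp, forall_eq] at hl
  obtain ⟨hu, hv, hx, hy, hz⟩ := hl
  have mem {a b c d : ℕ} (ha : a ∈ Finset.Icc 1 8) (hb : b ∈ Finset.Icc 1 8)
      (hc : c ∈ Finset.Icc 1 8) (hd : d ∈ Finset.Icc 1 8) (h : Holds K f (bits [a, b, c, d])) :
      ({f a, f b, f c, f d} : Finset α) ∈ facets K 3 := by
    rw [Holds, dec_bits (by
      simp only [List.mem_cons, List.not_mem_nil, or_false, forall_eq_or_imp, forall_eq]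
      exact ⟨ha, hb, hc, hd⟩)] at h
    simpa using h
  have hs : dec (bits [u, v, w]) ⊆ dec m := subset_of_mem_supers hm
  rw [dec_bits (by
    simp only [List.mem_cons, List.not_mem_nil, or_false, forall_eq_or_imp, forall_eq]
    exact ⟨hu, hv, hw⟩)] at hs
  have := hK.ring (mem hu hv hx hy h₁) (mem hu hv hy hz h₂) (mem hu hv hx hz h₃) h
    (Finset.mem_image_of_mem f (hs (by simp))) (Finset.mem_image_of_mem f (hs (by simp)))
    (Finset.mem_image_of_mem f (hs (show w ∈ _ by simp)))
  simp only [Finset.mem_insert, Finset.mem_singleton] at this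
  refine hw' ?_
  simp only [List.mem_cons, List.not_mem_nil, or_false]
  exact this.imp (hf.injOn hw hu) <| .imp (hf.injOn hw hv) <| .imp (hf.injOn hw hx) <|
    .imp (hf.injOn hw hy) (hf.injOn hw hz)

end Labelling

end Labelling

section Soundness

variable {α : Type*} [DecidableEq α] {K : Complex α}

/-- A neighbourly normal 3-pseudomanifold containing a copy of the pattern `A` is in the list. -/
def Known (K : Complex α) (A : List ℕ) : Prop :=
  ∀ f, Labelling K f → (∀ m ∈ A, Holds K f m) → ∃ X ∈ L19, Iso K X

/-- Every numbering of `K` for which the sets in `a` are facets and those in `b` are not proves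
the classification. -/
def Settled (K : Complex α) (a b : ℕ) : Prop :=
  ∀ f, Labelling K f → (∀ m, a.testBit m = true → Holds K f m) →
    (∀ m, b.testBit m = true → ¬ Holds K f m) → ∃ X ∈ L19, Iso K X

theorem testBit_two_pow_or {P : ℕ → Prop} {a m : ℕ} (hm : P m)
    (ha : ∀ m, a.testBit m = true → P m) (m' : ℕ) (h : (2 ^ m ||| a).testBit m' = true) : P m' := by
  rw [Nat.testBit_or, Nat.testBit_two_pow, Bool.or_eq_true, decide_eq_true_eq] at h
  rcases h with rfl | h
  exacts [hm, ha m' h]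

theorem testBit_bits_or {P : ℕ → Prop} {b : ℕ} {l : List ℕ} (hl : ∀ m ∈ l, P m)
    (hb : ∀ m, b.testBit m = true → P m) (m : ℕ) (h : (bits l ||| b).testBit m = true) : P m := by
  rw [Nat.testBit_or, Bool.or_eq_true, testBit_bits] at h
  exact h.elim (hl m) (hb m)

theorem Settled.of_holds {a b m : ℕ} (h : Settled K (2 ^ m ||| a) b)
    (hm : ∀ f, Labelling K f → (∀ m, a.testBit m = true → Holds K f m) →
      (∀ m, b.testBit m = true → ¬ Holds K f m) → Holds K f m) : Settled K a b :=
  fun f hf ha hb => h f hf (testBit_two_pow_or (hm f hf ha hb) ha) hb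

theorem Settled.of_not_holds {a b : ℕ} {l : List ℕ} (h : Settled K a (bits l ||| b))
    (hl : ∀ f, Labelling K f → (∀ m, a.testBit m = true → Holds K f m) →
      (∀ m, b.testBit m = true → ¬ Holds K f m) → ∀ m ∈ l, ¬ Holds K f m) : Settled K a b :=
  fun f hf ha hb => h f hf ha (testBit_bits_or (hl f hf ha hb) hb)

theorem bits_singleton (m : ℕ) : bits [m] = 2 ^ m := by simp [bits]

theorem dec_renumber {π : List ℕ} (h : ∀ i ∈ Finset.Icc 1 8, π.getD (i - 1) 0 ∈ Finset.Icc 1 8)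
    (m : ℕ) : dec (renumber π m) = (dec m).image fun i => π.getD (i - 1) 0 := by
  have hi (i : ℕ) : 1 ≤ i ∧ i < 1 + 8 ↔ i ∈ Finset.Icc 1 8 := by
    rw [Finset.mem_Icc]; omega
  rw [renumber, dec_bits]
  · ext v
    simp only [List.mem_toFinset, List.mem_map, List.mem_filter, List.mem_range'_1, hi,
      Finset.mem_image, mem_dec]
  · intro v hv
    simp only [List.mem_map, List.mem_filter, List.mem_range'_1, hi] at hv
    obtain ⟨i, ⟨hi, -⟩, rfl⟩ := hv
    exact h i hi

theorem Labelling.comp {f : ℕ → α} (hf : Labelling K f) {p : ℕ → ℕ}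
    (hp : ∀ i ∈ Finset.Icc 1 8, p i ∈ Finset.Icc 1 8)
    (hinj : Set.InjOn p (Finset.Icc 1 8 : Finset ℕ)) : Labelling K (f ∘ p) := by
  refine ⟨hf.injOn.comp hinj hp, ?_⟩
  rw [← Finset.image_image, ← hf.image_eq]
  congr 1
  exact Finset.eq_of_subset_of_card_le (Finset.image_subset_iff.2 hp)
    (Finset.card_image_of_injOn hinj).ge

theorem Settled.of_known {A π : List ℕ} (hA : Known K A) {a b : ℕ}
    (h₁ : ((List.range' 1 8).map fun i => π.getD (i - 1) 0).Nodup)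
    (h₂ : ∀ i ∈ Finset.Icc 1 8, π.getD (i - 1) 0 ∈ Finset.Icc 1 8)
    (h₃ : ∀ m ∈ A, a.testBit (renumber π m) = true) : Settled K a b := by
  intro f hf ha _
  refine hA (f ∘ fun i => π.getD (i - 1) 0) (hf.comp h₂ ?_) fun m hm => ?_
  · intro i hi j hj e
    simp only [Finset.coe_Icc, Set.mem_Icc] at hi hj
    exact List.inj_on_of_nodup_map h₁ (List.mem_range'_1.2 (by omega))
      (List.mem_range'_1.2 (by omega)) e
  · have := ha _ (h₃ m hm)
    rwa [Holds, dec_renumber h₂, Finset.image_image] at this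

theorem settled_of_run (hK : NormalPM K 3) (hN : Neighbourly K) {db : List (List ℕ)}
    (hdb : ∀ A ∈ db, Known K A) (ops : List Op) (a b : ℕ) (st : List (ℕ × ℕ))
    (h : run db ops a b st = true) : Settled K a b ∧ ∀ p ∈ st, Settled K p.1 p.2 := by
  induction ops generalizing a b st with
  | nil => simp [run] at h
  | cons op ops ih =>
    have hclose (h : resume (run db ops) st = true) : ∀ p ∈ st, Settled K p.1 p.2 := by
      cases st with
      | nil => simp
      | cons p st =>
        obtain ⟨h1, h2⟩ := ih _ _ _ h
        exact List.forall_mem_cons.2 ⟨h1, h2⟩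
    cases op with
    | tri t =>
      simp only [run] at h
      have hy (m : ℕ) : m ∈ (supers t).filter a.testBit ↔ m ∈ supers t ∧ a.testBit m = true :=
        List.mem_filter
      have hu (m : ℕ) : m ∈ (supers t).filter (fun m => !a.testBit m && !b.testBit m) ↔
          m ∈ supers t ∧ a.testBit m = false ∧ b.testBit m = false := by
        simp
      have hnd := (nodup_supers t).filter a.testBit
      have other {f : ℕ → α} (hf : Labelling K f) (hb : ∀ m, b.testBit m = true → ¬ Holds K f m)
          {m : ℕ} (hm : m ∈ supers t) (h : Holds K f m) :
          ∃ m', m' ≠ m ∧ Holds K f m' ∧ (m' ∈ (supers t).filter a.testBit ∨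
            m' ∈ (supers t).filter fun m => !a.testBit m && !b.testBit m) := by
        obtain ⟨m', hm', hne, h'⟩ := hf.exists_ne hK.1 hm h
        refine ⟨m', hne, h', ?_⟩
        rw [hy, hu]
        cases ha : a.testBit m' with
        | true => simp [hm']
        | false => simpa [hm'] using fun hbm => hb m' hbm h'
      revert h hy hu hnd other
      generalize (supers t).filter a.testBit = y
      generalize (supers t).filter (fun m => !a.testBit m && !b.testBit m) = u
      intro h hy hu hnd other
      split at h
      · obtain ⟨h1, h2⟩ := ih _ _ _ h
        rw [← bits_singleton] at h1
        refine ⟨h1.of_not_holds fun f hf ha hb m hm hh => ?_, h2⟩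
        obtain ⟨m', hne, -, h' | h'⟩ := other hf hb ((hu m).1 hm).1 hh
        · simp at h'
        · exact hne ((List.mem_singleton.1 h').trans (List.mem_singleton.1 hm).symm)
      · refine ⟨fun f hf ha hb => ?_, hclose h⟩
        obtain ⟨h1, h2⟩ := (hy _).1 (List.mem_singleton_self _)
        obtain ⟨m', hne, -, h' | h'⟩ := other hf hb h1 (ha _ h2)
        · exact absurd (List.mem_singleton.1 h') hne
        · simp at h'
      · obtain ⟨h1, h2⟩ := ih _ _ _ h
        refine ⟨h1.of_holds fun f hf ha hb => ?_, h2⟩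
        obtain ⟨h1, h2⟩ := (hy _).1 (List.mem_singleton_self _)
        obtain ⟨m', hne, hh, h' | h'⟩ := other hf hb h1 (ha _ h2)
        · exact absurd (List.mem_singleton.1 h') hne
        · rwa [← List.mem_singleton.1 h']
      · obtain ⟨h1, h2⟩ := ih _ _ _ h
        rename_i p q
        refine ⟨h1.of_not_holds fun f hf ha hb m hm hh => ?_, h2⟩
        obtain ⟨hp, hpa⟩ := (hy p).1 (by simp)
        obtain ⟨hq, hqa⟩ := (hy q).1 (by simp)
        obtain ⟨hm, hma, -⟩ := (hu m).1 hm
        rcases hf.eq_or_eq hK.1 hp hq hm (ha p hpa) (ha q hqa) hh (by simpa using hnd) with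
          rfl | rfl <;> simp_all
      · rename_i p q r _
        refine ⟨fun f hf ha hb => ?_, hclose h⟩
        obtain ⟨hp, hpa⟩ := (hy p).1 (by simp)
        obtain ⟨hq, hqa⟩ := (hy q).1 (by simp)
        obtain ⟨hr, hra⟩ := (hy r).1 (by simp)
        simp only [List.nodup_cons, List.mem_cons, not_or] at hnd
        rcases hf.eq_or_eq hK.1 hp hq hr (ha p hpa) (ha q hqa) (ha r hra) hnd.1.1 with
          rfl | rfl <;> simp_all
      · simp at h
    | edge u v =>
      simp only [run, Bool.and_eq_true, bne_iff_ne, decide_eq_true_eq, List.all_eq_true] at h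
      obtain ⟨⟨⟨⟨⟨⟨hne, hu⟩, hu'⟩, hv⟩, hv'⟩, hall⟩, h⟩ := h
      refine ⟨fun f hf _ hb => ?_, hclose h⟩
      obtain ⟨m, hm, hh⟩ := hf.exists_facet_of_edge hK.1 hN (Finset.mem_Icc.2 ⟨hu, hu'⟩)
        (Finset.mem_Icc.2 ⟨hv, hv'⟩) hne
      exact absurd hh (hb m (hall m hm))
    | ring u v x y z =>
      simp only [run, Bool.and_eq_true, List.all_eq_true, decide_eq_true_eq] at h
      obtain ⟨⟨⟨⟨hl, h₁⟩, h₂⟩, h₃⟩, h⟩ := h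
      have key : ∀ f, Labelling K f → (∀ m, a.testBit m = true → Holds K f m) →
          ∀ m ∈ ((List.range' 1 8).filter fun w => !(bits [u, v, x, y, z]).testBit w).flatMap
            fun w => supers (bits [u, v, w]), ¬ Holds K f m := by
        intro f hf ha m hm
        obtain ⟨w, hw, hm⟩ := List.mem_flatMap.1 hm
        rw [List.mem_filter, List.mem_range'_1, Bool.not_eq_true', ← Bool.not_eq_true,
          testBit_bits] at hw
        exact hf.ring hK (fun i hi => Finset.mem_Icc.2 (hl i hi)) (ha _ h₁) (ha _ h₂) (ha _ h₃)
          (Finset.mem_Icc.2 (by omega)) hw.2 hm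
      revert h key
      generalize ((List.range' 1 8).filter fun w => !(bits [u, v, x, y, z]).testBit w).flatMap
        (fun w => supers (bits [u, v, w])) = l
      intro h key
      cases hla : l.any a.testBit with
      | true =>
        rw [hla, cond_true] at h
        obtain ⟨m, hm, hma⟩ := List.any_eq_true.1 hla
        exact ⟨fun f hf ha _ => absurd (ha m hma) (key f hf ha m hm), hclose h⟩
      | false =>
        rw [hla, cond_false] at h
        obtain ⟨h1, h2⟩ := ih _ _ _ h
        exact ⟨h1.of_not_holds fun f hf ha _ => key f hf ha, h2⟩
    | split m =>
      simp only [run] at h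
      obtain ⟨h1, h2⟩ := ih _ _ _ h
      refine ⟨fun f hf ha hb => ?_, fun p hp => h2 p (List.mem_cons_of_mem _ hp)⟩
      rw [← bits_singleton] at h2
      by_cases hm : Holds K f m
      · exact h1 f hf (testBit_two_pow_or hm ha) hb
      · exact h2 _ List.mem_cons_self f hf ha
          (testBit_bits_or (by simpa using hm) hb)
    | known j π =>
      simp only [run, Bool.and_eq_true, decide_eq_true_eq, List.all_eq_true] at h
      obtain ⟨⟨⟨h₁, h₂⟩, h₃⟩, h⟩ := h
      refine ⟨?_, hclose h⟩
      split at h₃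
      · simp at h₃
      · rename_i A hA
        exact Settled.of_known (hdb A (List.mem_of_getElem? hA)) h₁
          (fun i hi => Finset.mem_Icc.2 (h₂ i (by
            rw [Finset.mem_Icc] at hi; exact List.mem_range'_1.2 (by omega))))
          (by simpa using h₃)

theorem known_of_verify (hK : NormalPM K 3) (hN : Neighbourly K) (db : List (List ℕ))
    (hdb : ∀ A ∈ db, Known K A) (l : List (List ℕ × List Op)) (h : verify db l = true) :
    ∀ p ∈ l, Known K p.1 := by
  induction l generalizing db with
  | nil => simp
  | cons p l ih =>
    obtain ⟨A, ops⟩ := p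
    rw [verify, Bool.and_eq_true] at h
    have hA : Known K A := fun f hf hA =>
      (settled_of_run hK hN hdb ops _ _ _ h.1).1 f hf (fun m hm => hA m (testBit_bits.1 hm))
        (by simp)
    refine List.forall_mem_cons.2 ⟨hA, ih (db ++ [A]) ?_ h.2⟩
    simpa [or_imp, forall_and] using ⟨hdb, hA⟩

end Soundness

section Classification

variable {α : Type*} [DecidableEq α] {K : Complex α}

theorem genCx_facets (hK : WeakPM K 3) : genCx (facets K 3) = K := by
  ext σ
  rw [mem_genCx]
  constructor
  · rintro ⟨hn, τ, hτ, hs⟩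
    exact hK.1.2.2 τ (mem_facets.1 hτ).1 σ hs hn
  · intro hσ
    obtain ⟨τ, hτ, hs, hc⟩ := hK.2.1 σ hσ
    exact ⟨hK.1.2.1 σ hσ, τ, mem_facets.2 ⟨hτ, hc⟩, hs⟩

theorem genCx_image {β : Type*} [DecidableEq β] (f : β → α) (F : Finset (Finset β)) :
    genCx (F.image fun σ => σ.image f) = (genCx F).image fun σ => σ.image f := by
  ext σ
  simp only [mem_genCx, Finset.mem_image]
  constructor
  · rintro ⟨hn, _, ⟨τ, hτ, rfl⟩, hs⟩
    obtain ⟨ρ, hρ, rfl⟩ := Finset.subset_image_iff.1 hs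
    exact ⟨ρ, ⟨Finset.image_nonempty.1 hn, τ, hτ, by exact_mod_cast hρ⟩, rfl⟩
  · rintro ⟨ρ, ⟨hn, τ, hτ, hs⟩, rfl⟩
    exact ⟨hn.image f, _, ⟨τ, hτ, rfl⟩, Finset.image_subset_image hs⟩

theorem facets_eq_of_good (hK : NormalPM K 3) {C : List ℕ} (hC : good C = true) {f : ℕ → α}
    (hf : Labelling K f) (h : ∀ c ∈ C, Holds K f c) :
    facets K 3 = (faces C).image fun σ => σ.image f := by
  have hsub : ∀ σ ∈ (faces C).image fun σ => σ.image f, σ ∈ facets K 3 := by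
    intro σ hσ
    obtain ⟨_, hτ, rfl⟩ := Finset.mem_image.1 hσ
    obtain ⟨c, hc, rfl⟩ := mem_faces.1 hτ
    exact h c hc
  refine Finset.Subset.antisymm (fun σ hσ => ?_) hsub
  have hW := weakPM_of_good hC
  obtain ⟨e, heσ, he⟩ := Finset.exists_subset_card_eq
    (show 2 ≤ σ.card by rw [(mem_facets.1 hσ).2]; omega)
  obtain ⟨p, q, hpq, rfl⟩ := Finset.card_eq_two.1 he
  obtain ⟨u, hu, rfl⟩ := Finset.mem_image.1 (hf.subset_image hσ (heσ (show p ∈ _ by simp)))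
  obtain ⟨v, hv, rfl⟩ := Finset.mem_image.1 (hf.subset_image hσ (heσ (show q ∈ _ by simp)))
  refine hK.star_subset he (M := ((faces C).image fun σ => σ.image f : Finset (Finset α)))
    hsub ?_ ?_ hσ heσ
  · obtain ⟨-, τ, hτ, hs⟩ := mem_genCx.1 (neighbourly_of_good hC u (by rwa [verts_of_good hC]) v
      (by rwa [verts_of_good hC]) fun e => hpq (e ▸ rfl))
    exact ⟨τ.image f, Finset.mem_image_of_mem _ hτ, by
      simpa [Finset.image_insert] using Finset.image_subset_image (f := f) hs⟩
  · rintro t ht - σ hσ hts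
    obtain ⟨ρ, hρ, rfl⟩ := Finset.mem_image.1 hσ
    have hsubset {ρ : Finset ℕ} (hρ : ρ ∈ faces C) : ρ ⊆ Finset.Icc 1 8 := by
      obtain ⟨c, -, rfl⟩ := mem_faces.1 hρ
      exact dec_subset c
    obtain ⟨s, hs, rfl⟩ := Finset.subset_image_iff.1 hts
    rw [Finset.card_image_of_injOn (hf.injOn.mono
      (Finset.coe_subset.2 (hs.trans (hsubset hρ))))] at ht
    obtain ⟨τ, hτ, hsτ, hne⟩ := hW.exists_ne_facet ht (by rwa [facets_of_good hC]) hs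
    rw [facets_of_good hC] at hτ
    refine ⟨τ.image f, Finset.mem_image_of_mem _ hτ, Finset.image_subset_image hsτ, fun h => hne ?_⟩
    have inj {τ ρ : Finset ℕ} (hτ : τ ∈ faces C) (hρ : ρ ∈ faces C) (h : τ.image f = ρ.image f) :
        τ ⊆ ρ := by
      intro x hx
      obtain ⟨y, hy, e⟩ := Finset.mem_image.1 (h ▸ Finset.mem_image_of_mem f hx)
      exact hf.injOn (hsubset hρ hy) (hsubset hτ hx) e ▸ hy
    exact (inj hτ hρ h).antisymm (inj hρ hτ h.symm)

theorem known_of_good (hK : NormalPM K 3) {C : List ℕ} (hC : good C = true)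
    (hX : genCx (faces C) ∈ L19) : Known K C := by
  intro f hf h
  refine ⟨_, hX, Function.invFunOn f (Finset.Icc 1 8 : Finset ℕ), ?_, ?_⟩
  · rw [← hf.image_eq, Finset.coe_image]
    exact Function.invFunOn_injOn_image f _
  · rw [← genCx_facets hK.1, facets_eq_of_good hK hC hf h, genCx_image, Finset.image_image]
    conv_lhs => rw [← Finset.image_id (s := genCx (faces C))]
    refine Finset.image_congr fun σ hσ => ?_
    have hσ : σ ⊆ Finset.Icc 1 8 := by
      rw [← verts_of_good hC]
      exact fun v hv => mem_verts.2 ⟨σ, hσ, hv⟩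
    rw [Function.comp, Finset.image_image]
    conv_lhs => rw [id, ← Finset.image_id (s := σ)]
    exact Finset.image_congr fun x hx => (hf.injOn.leftInvOn_invFunOn (hσ hx)).symm

/-- Every neighbourly normal 3-pseudomanifold on 8 vertices can be numbered so that
`{1, 2, 3, 4}` and `{1, 2, 3, 5}` are facets. -/
theorem exists_labelling (hK : NormalPM K 3) (h8 : (verts K).card = 8) :
    ∃ f, Labelling K f ∧ ∀ m ∈ [30, 46], Holds K f m := by
  obtain ⟨σ₀, hσ₀⟩ := hK.1.1.1
  obtain ⟨σ, hσ, -, hσc⟩ := hK.1.2.1 σ₀ hσ₀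
  have hσ := mem_facets.2 ⟨hσ, hσc⟩
  obtain ⟨t, hts, ht⟩ := Finset.exists_subset_card_eq (show 3 ≤ σ.card by omega)
  obtain ⟨τ, hτ, htτ, hne⟩ := hK.1.exists_ne_facet ht hσ hts
  have single {ρ : Finset α} (hρ : ρ ∈ facets K 3) (h : t ⊆ ρ) : ∃ p ∉ t, ρ = insert p t := by
    obtain ⟨p, hp⟩ := Finset.card_eq_one.1 (show (ρ \ t).card = 1 by
      rw [Finset.card_sdiff_of_subset h, ht, (mem_facets.1 hρ).2])
    refine ⟨p, (Finset.mem_sdiff.1 (hp ▸ Finset.mem_singleton_self p)).2, ?_⟩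
    rw [Finset.insert_eq, ← hp, Finset.sdiff_union_of_subset h]
  obtain ⟨p, hp, rfl⟩ := single hσ hts
  obtain ⟨q, hq, rfl⟩ := single hτ htτ
  obtain ⟨a, b, c, hab, hac, hbc, rfl⟩ := Finset.card_eq_three.1 ht
  have hsub {ρ : Finset α} (hρ : ρ ∈ facets K 3) : ρ ⊆ verts K :=
    fun v hv => mem_verts.2 ⟨ρ, (mem_facets.1 hρ).1, hv⟩
  have hpq : q ≠ p := fun e => hne (e ▸ rfl)
  simp only [Finset.mem_insert, Finset.mem_singleton, not_or] at hp hq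
  have h5 : ({a, b, c, p, q} : Finset α) ⊆ verts K := by
    have h1 := hsub hσ
    have h2 := hsub hτ
    simp only [Finset.insert_subset_iff, Finset.singleton_subset_iff] at h1 h2 ⊢
    tauto
  have hc5 : ({a, b, c, p, q} : Finset α).card = 5 := by
    have : [a, b, c, p, q].Nodup := by
      simp only [List.nodup_cons, List.mem_cons, List.not_mem_nil, or_false, not_or,
        not_false_eq_true, List.nodup_nil, and_true]
      exact ⟨⟨hab, hac, Ne.symm hp.1, Ne.symm hq.1⟩, ⟨hbc, Ne.symm hp.2.1, Ne.symm hq.2.1⟩,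
        ⟨Ne.symm hp.2.2, Ne.symm hq.2.2⟩, hpq.symm⟩
    simpa using List.toFinset_card_of_nodup this
  obtain ⟨x, y, z, hxy, hxz, hyz, hr⟩ := Finset.card_eq_three.1
    (show (verts K \ {a, b, c, p, q}).card = 3 by rw [Finset.card_sdiff_of_subset h5, h8, hc5])
  have himg : (Finset.Icc 1 8).image (fun i => [a, b, c, p, q, x, y, z].getD (i - 1) a) = verts K := by
    rw [← Finset.union_sdiff_of_subset h5, hr]
    ext v
    simp only [show Finset.Icc 1 8 = {1, 2, 3, 4, 5, 6, 7, 8} from rfl, Finset.image_insert,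
      Finset.image_singleton, Finset.mem_union, Finset.mem_insert, Finset.mem_singleton]
    simp only [Nat.reduceSub, List.getD_cons_zero, List.getD_cons_succ, or_assoc]
  refine ⟨_, ⟨?_, himg⟩, ?_⟩
  · exact Finset.card_image_iff.1 (by rw [himg, h8, Nat.card_Icc])
  · simp only [List.mem_cons, List.not_mem_nil, or_false, forall_eq_or_imp, forall_eq, Holds]
    rw [show dec 30 = {1, 2, 3, 4} by decide +kernel, show dec 46 = {1, 2, 3, 5} by decide +kernel]
    have e (p : α) : insert p {a, b, c} = ({a, b, c, p} : Finset α) := by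
      rw [Finset.insert_comm p a, Finset.insert_comm p b, Finset.pair_comm p c]
    simp only [Finset.image_insert, Finset.image_singleton, Nat.reduceSub, List.getD_cons_zero,
      List.getD_cons_succ]
    exact ⟨e p ▸ hσ, e q ▸ hτ⟩

end Classification

section Catalogue

/-- The facets of `S35`, as numbers with these binary digits. -/
def cS35 : List ℕ :=
  [30, 270, 54, 102, 198, 390, 282, 306, 354, 450, 60, 108, 204, 396, 120, 216, 408, 240, 432,
   480]

/-- The facets of `S36`, as numbers with these binary digits. -/
def cS36 : List ℕ :=
  [30, 270, 54, 102, 326, 282, 306, 226, 418, 450, 60, 108, 204, 396, 452, 120, 216, 408, 240,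
   432]

/-- The facets of `S37`, as numbers with these binary digits. -/
def cS37 : List ℕ :=
  [30, 270, 54, 102, 326, 282, 178, 402, 354, 418, 60, 108, 204, 396, 452, 120, 216, 408, 240,
   480]

/-- The facets of `S38`, as numbers with these binary digits. -/
def cS38 : List ℕ :=
  [30, 142, 278, 198, 326, 154, 402, 226, 354, 418, 60, 300, 204, 332, 308, 120, 216, 360, 240,
   432]

/-- The facets of `N1`, as numbers with these binary digits. -/
def cN1 : List ℕ :=
  [46, 78, 150, 278, 166, 326, 58, 282, 202, 394, 114, 210, 354, 418, 92, 156, 300, 396, 116,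
   308, 228, 452, 184, 344, 232, 360, 432, 464]

/-- The facets of `N2`, as numbers with these binary digits. -/
def cN2 : List ℕ :=
  [150, 278, 198, 326, 154, 282, 394, 226, 354, 418, 172, 300, 396, 180, 308, 452, 216, 344,
   232, 360, 432, 464]

/-- The facets of `N3`, as numbers with these binary digits. -/
def cN3 : List ℕ :=
  [30, 46, 278, 102, 326, 282, 170, 394, 354, 418, 156, 300, 396, 116, 308, 212, 452, 120, 184,
   344, 360, 432, 464]

/-- The facets of `N4`, as numbers with these binary digits. -/
def cN4 : List ℕ :=
  [54, 278, 102, 326, 154, 282, 394, 178, 354, 418, 108, 300, 204, 396, 308, 452, 216, 344, 360,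
   432, 464]

/-- The facets of `N5`, as numbers with these binary digits. -/
def cN5 : List ℕ :=
  [166, 294, 198, 326, 106, 298, 202, 394, 114, 178, 338, 402, 108, 172, 332, 396, 116, 308,
   212, 404, 184, 312, 216, 344]

/-- The facets of `N6`, as numbers with these binary digits. -/
def cN6 : List ℕ :=
  [46, 78, 54, 86, 298, 202, 394, 178, 338, 402, 226, 354, 172, 332, 396, 308, 212, 404, 228,
   356, 184, 312, 216, 344]

/-- The facets of `N7`, as numbers with these binary digits. -/
def cN7 : List ℕ :=
  [102, 294, 326, 106, 298, 202, 394, 210, 338, 402, 108, 172, 332, 396, 180, 308, 404, 184,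
   312, 216, 344]

/-- The facets of `N8`, as numbers with these binary digits. -/
def cN8 : List ℕ :=
  [46, 78, 294, 326, 90, 154, 298, 394, 338, 402, 172, 204, 180, 308, 404, 452, 120, 184, 360,
   456, 368]

/-- The facets of `N9`, as numbers with these binary digits. -/
def cN9 : List ℕ :=
  [102, 294, 326, 90, 154, 106, 298, 394, 338, 402, 204, 332, 396, 180, 308, 404, 228, 184, 312,
   344, 232]

/-- The facets of `N10`, as numbers with these binary digits. -/
def cN10 : List ℕ :=
  [102, 294, 326, 90, 154, 106, 298, 394, 210, 450, 108, 172, 332, 396, 180, 308, 404, 184, 312,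
   344, 464]

/-- The facets of `N11`, as numbers with these binary digits. -/
def cN11 : List ℕ :=
  [46, 78, 294, 326, 90, 154, 298, 394, 210, 450, 172, 332, 396, 180, 308, 404, 120, 184, 360,
   368, 464]

/-- The facets of `N12`, as numbers with these binary digits. -/
def cN12 : List ℕ :=
  [102, 294, 326, 90, 154, 106, 298, 394, 338, 402, 60, 156, 172, 308, 404, 228, 452, 312, 344,
   232, 456]

/-- The facets of `N13`, as numbers with these binary digits. -/
def cN13 : List ℕ :=
  [102, 294, 326, 90, 154, 106, 298, 394, 338, 402, 108, 172, 204, 180, 308, 404, 452, 184, 312,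
   344, 456]

/-- The facets of `N14`, as numbers with these binary digits. -/
def cN14 : List ℕ :=
  [46, 78, 294, 326, 90, 154, 170, 338, 402, 418, 60, 156, 204, 308, 404, 452, 120, 360, 424,
   456, 368]

/-- The facets of `N15`, as numbers with these binary digits. -/
def cN15 : List ℕ :=
  [46, 270, 102, 326, 90, 154, 106, 394, 338, 402, 300, 180, 308, 404, 228, 452, 184, 312, 344,
   232, 456]

theorem S35_eq : S35 = genCx (faces cS35) := congrArg genCx (by decide +kernel)

theorem S36_eq : S36 = genCx (faces cS36) := congrArg genCx (by decide +kernel)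

theorem S37_eq : S37 = genCx (faces cS37) := congrArg genCx (by decide +kernel)

theorem S38_eq : S38 = genCx (faces cS38) := congrArg genCx (by decide +kernel)

theorem N1_eq : N1 = genCx (faces cN1) := congrArg genCx (by decide +kernel)

theorem N2_eq : N2 = genCx (faces cN2) := congrArg genCx (by decide +kernel)

theorem N3_eq : N3 = genCx (faces cN3) := congrArg genCx (by decide +kernel)

theorem N4_eq : N4 = genCx (faces cN4) := congrArg genCx (by decide +kernel)

theorem N5_eq : N5 = genCx (faces cN5) := congrArg genCx (by decide +kernel)

theorem N6_eq : N6 = genCx (faces cN6) := congrArg genCx (by decide +kernel)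

theorem N7_eq : N7 = genCx (faces cN7) := congrArg genCx (by decide +kernel)

theorem N8_eq : N8 = genCx (faces cN8) := by
  rw [N8, N7_eq, kappa_genCx, kappa_genCx, kappa_genCx, kappa_genCx]
  · exact congrArg genCx (by decide +kernel)
  all_goals decide +kernel

theorem N9_eq : N9 = genCx (faces cN9) := by
  rw [N9, N7_eq, kappa_genCx, kappa_genCx]
  · exact congrArg genCx (by decide +kernel)
  all_goals decide +kernel

theorem N10_eq : N10 = genCx (faces cN10) := by
  rw [N10, N7_eq, kappa_genCx, kappa_genCx]
  · exact congrArg genCx (by decide +kernel)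
  all_goals decide +kernel

theorem N11_eq : N11 = genCx (faces cN11) := by
  rw [N11, N10_eq, kappa_genCx, kappa_genCx]
  · exact congrArg genCx (by decide +kernel)
  all_goals decide +kernel

theorem N12_eq : N12 = genCx (faces cN12) := by
  rw [N12, N9_eq, kappa_genCx, kappa_genCx]
  · exact congrArg genCx (by decide +kernel)
  all_goals decide +kernel

theorem N13_eq : N13 = genCx (faces cN13) := by
  rw [N13, N9_eq, kappa_genCx, kappa_genCx]
  · exact congrArg genCx (by decide +kernel)
  all_goals decide +kernel

theorem N14_eq : N14 = genCx (faces cN14) := by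
  rw [N14, N8_eq, kappa_genCx, kappa_genCx]
  · exact congrArg genCx (by decide +kernel)
  all_goals decide +kernel

theorem N15_eq : N15 = genCx (faces cN15) := by
  rw [N15, N9_eq, kappa_genCx, kappa_genCx]
  · exact congrArg genCx (by decide +kernel)
  all_goals decide +kernel

/-- The codes of the facets of the complexes in `L19`. -/
def codes : List (List ℕ) :=
  [cS35, cS36, cS37, cS38, cN1, cN2, cN3, cN4, cN5, cN6, cN7,
    cN8, cN9, cN10, cN11, cN12, cN13, cN14, cN15]

theorem L19_eq : L19 = codes.map fun C => genCx (faces C) := by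
  simp only [codes, List.map_cons, List.map_nil, ← S35_eq, ← S36_eq, ← S37_eq, ← S38_eq, ← N1_eq,
    ← N2_eq, ← N3_eq, ← N4_eq, ← N5_eq, ← N6_eq, ← N7_eq, ← N8_eq, ← N9_eq, ← N10_eq, ← N11_eq, ←
    N12_eq, ← N13_eq, ← N14_eq, ← N15_eq, L19]

theorem good_of_mem_codes {C : List ℕ} (hC : C ∈ codes) : good C = true :=
  List.all_eq_true.1 (show codes.all good = true by decide +kernel) C hC

end Catalogue

/-- Patterns of facets, and derivations that reduce each of them to earlier ones. -/
def derivations : List (List ℕ × List Op) := [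
  ([30, 54, 102, 198, 390, 270, 58, 332, 394, 184], [
    .tri 14, .tri 22, .tri 26, .tri 38, .tri 50, .tri 56, .tri 266, .tri 268, .tri 386, .tri 146,
    .tri 274, .tri 290, .split 108, .tri 44, .tri 76, .tri 140, .tri 168, .tri 42, .tri 74,
    .ring 3 7 2 4 5, .tri 44, .split 228, .tri 196, .tri 76, .ring 2 6 1 5 7, .split 232,
    .tri 168, .tri 42, .tri 74, .tri 200, .tri 76, .ring 3 6 1 5 7, .split 106, .tri 42, .tri 74,
    .tri 104, .tri 168, .tri 328, .tri 392, .split 180, .tri 52, .tri 100, .tri 164, .tri 176,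
    .tri 304, .tri 324, .tri 336, .tri 388, .edge 4 8, .tri 164, .split 212, .tri 196, .tri 200,
    .tri 208, .tri 388, .tri 400, .tri 76, .tri 84, .tri 100, .tri 276,
    .known 11 [1, 5, 2, 7, 4, 6, 8, 3], .split 116, .tri 52, .split 92, .tri 28, .tri 76, .tri 84,
    .tri 88, .tri 148, .tri 196, .split 240, .tri 112, .tri 176, .tri 208, .edge 4 8, .tri 112,
    .tri 176, .tri 208, .known 13 [5, 2, 3, 7, 1, 4, 8, 6], .tri 28, .tri 76, .tri 84, .tri 148,
    .ring 6 7 1 2 3, .tri 112, .tri 176, .known 15 [7, 5, 2, 1, 4, 8, 6, 3], .tri 100, .tri 324,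
    .tri 352, .tri 448, .tri 84, .tri 88, .tri 112, .edge 4 6, .tri 42, .tri 74, .tri 98,
    .tri 104, .tri 168, .split 92, .tri 28, .tri 76, .split 340, .tri 84, .tri 100, .tri 324,
    .split 116, .tri 52, .tri 84, .tri 100, .tri 164, .tri 196, .split 240, .tri 112, .tri 176,
    .tri 224, .edge 5 8, .tri 112, .tri 176, .tri 224, .tri 448, .tri 328, .tri 392,
    .known 2 [5, 6, 2, 1, 7, 8, 3, 4], .tri 84, .tri 100, .tri 196, .split 240, .tri 112,
    .tri 176, .tri 208, .tri 304, .tri 336, .tri 148, .tri 152,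
    .known 12 [8, 1, 4, 6, 7, 3, 5, 2], .tri 112, .tri 224, .split 180, .tri 52, .tri 148,
    .tri 164, .tri 176, .split 216, .tri 88, .tri 152, .tri 208, .edge 4 8, .tri 88, .tri 152,
    .tri 208, .known 14 [6, 5, 2, 3, 1, 8, 4, 7], .tri 52, .tri 148, .tri 176, .tri 400, .tri 448,
    .tri 152, .known 11 [8, 3, 2, 5, 1, 6, 4, 7], .tri 28, .tri 76, .tri 152, .tri 196, .tri 200,
    .tri 280, .split 180, .tri 52, .tri 84, .tri 176, .tri 208, .tri 304, .edge 4 6, .tri 148,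
    .tri 164, .split 116, .tri 52, .tri 84, .tri 100, .split 240, .tri 112, .tri 176, .tri 224,
    .edge 5 8, .tri 112, .tri 176, .tri 224, .known 16 [3, 5, 2, 8, 4, 1, 6, 7], .tri 52, .tri 84,
    .tri 100, .split 240, .tri 112, .tri 208, .known 14 [8, 3, 2, 5, 1, 6, 4, 7], .tri 112,
    .tri 208, .edge 4 6]),
  ([30, 54, 102, 198, 390, 270, 58, 332, 106], [
    .tri 14, .tri 22, .tri 26, .tri 38, .tri 42, .tri 50, .tri 70, .tri 98, .tri 162, .tri 268,
    .ring 1 4 2 3 5, .split 60, .tri 28, .tri 52, .tri 56, .ring 2 4 1 3 5, .ring 3 4 1 2 5,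
    .ring 4 5 1 2 3, .tri 208, .edge 4 6, .split 228, .tri 100, .tri 196, .tri 76,
    .ring 2 6 1 5 7, .split 202, .tri 138, .tri 194, .split 180,
    .known 19 [1, 3, 2, 4, 5, 6, 7, 8], .split 184, .known 19 [1, 2, 3, 4, 5, 6, 7, 8],
    .split 108, .tri 44, .tri 76, .tri 100, .tri 104, .tri 140, .tri 164, .tri 168, .tri 292,
    .tri 296, .tri 388, .tri 392, .tri 148, .tri 152, .tri 276, .tri 280,
    .known 5 [6, 7, 5, 1, 8, 4, 2, 3], .tri 44, .tri 164, .split 92, .tri 28, .tri 76, .split 232,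
    .ring 3 6 1 5 7, .tri 168, .split 340, .tri 84, .tri 100, .tri 324, .split 344, .tri 88,
    .tri 104, .tri 328, .split 116, .tri 52, .tri 84, .tri 100, .tri 148, .tri 196, .split 240,
    .tri 112, .tri 176, .tri 224, .tri 304, .tri 336, .tri 352, .tri 400, .tri 88,
    .known 10 [2, 5, 3, 7, 4, 1, 8, 6], .tri 176, .tri 224, .edge 5 7, .tri 52, .tri 84, .tri 100,
    .tri 148, .tri 196, .split 240, .tri 176, .tri 208, .tri 224, .tri 304, .tri 448, .tri 56,
    .known 10 [3, 5, 2, 7, 4, 1, 8, 6], .tri 176, .tri 224, .edge 5 7, .tri 28, .tri 76, .tri 196,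
    .tri 200, .tri 388, .tri 152, .tri 168, .tri 400, .tri 416, .tri 176, .edge 5 7, .tri 74,
    .tri 138, .tri 194, .tri 328, .ring 3 8 1 2 6, .split 452, .tri 324, .tri 388, .tri 448,
    .tri 276, .tri 336, .tri 400, .edge 4 8, .split 108, .tri 44, .tri 76, .tri 100, .tri 104,
    .tri 140, .tri 168, .tri 196, .tri 200, .tri 324, .tri 148, .tri 164, .tri 276,
    .ring 5 6 1 2 3, .tri 176, .tri 208, .known 7 [3, 6, 7, 5, 1, 8, 4, 2], .tri 44, .split 116,
    .tri 52, .tri 100, .tri 164, .tri 324, .tri 388, .tri 84, .tri 148, .tri 196, .split 368,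
    .tri 112, .tri 304, .tri 352, .tri 56, .tri 104, .known 18 [1, 5, 2, 8, 4, 3, 7, 6], .tri 304,
    .tri 352, .edge 5 8, .tri 100, .tri 324, .split 92, .tri 28, .tri 76, .tri 84, .split 120,
    .tri 56, .tri 88, .tri 104, .edge 3 7, .tri 56, .tri 88, .tri 104, .tri 208, .tri 336,
    .split 180, .tri 52, .tri 148, .tri 176, .edge 4 8, .tri 52, .tri 148,
    .known 19 [4, 2, 3, 6, 7, 8, 5, 1], .tri 76, .tri 84, .split 120, .tri 88,
    .known 19 [3, 6, 1, 5, 4, 7, 2, 8], .tri 56, .tri 88, .split 240, .tri 112, .tri 176,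
    .tri 208, .tri 304, .known 19 [8, 6, 2, 5, 4, 7, 1, 3], .tri 112, .tri 208, .edge 4 6]),
  ([30, 54, 102, 198, 390, 270, 58, 332], [
    .tri 14, .tri 22, .tri 26, .tri 38, .tri 50, .tri 70, .tri 268, .ring 1 4 2 3 5, .split 60,
    .tri 28, .tri 52, .tri 56, .ring 2 4 1 3 5, .ring 3 4 1 2 5, .ring 4 5 1 2 3, .tri 208,
    .edge 4 6, .split 106, .known 20 [1, 2, 3, 4, 5, 6, 7, 8], .split 228, .tri 100, .tri 196,
    .tri 76, .ring 2 6 1 5 7, .split 202, .tri 74, .tri 194, .tri 266, .tri 322, .tri 328,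
    .tri 386, .tri 42, .ring 3 8 1 2 6, .split 204, .tri 76, .tri 200, .tri 28, .tri 152,
    .known 20 [3, 1, 7, 5, 4, 2, 8, 6], .split 212, .tri 196, .split 92, .tri 76, .tri 84,
    .tri 100, .ring 5 6 1 2 8, .tri 88, .known 20 [6, 2, 3, 4, 7, 1, 5, 8], .tri 28, .tri 76,
    .tri 100, .tri 140, .tri 148, .tri 164, .tri 168, .tri 200, .tri 208, .tri 292, .tri 324,
    .tri 336, .tri 56, .known 6 [4, 5, 3, 1, 6, 8, 7, 2], .tri 196, .tri 324, .tri 388, .tri 276,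
    .ring 2 7 1 6 8, .tri 28, .tri 52, .known 20 [2, 6, 1, 5, 4, 3, 8, 7], .tri 74, .split 170,
    .tri 42, .tri 138, .tri 386, .tri 162, .tri 290, .split 184,
    .known 19 [1, 2, 3, 4, 5, 6, 7, 8], .split 424, .ring 3 7 1 5 8, .tri 28,
    .known 19 [1, 2, 3, 8, 7, 6, 5, 4], .split 108, .tri 44, .tri 76, .tri 100, .tri 140,
    .tri 168, .split 180, .ring 2 7 3 4 5, .tri 52, .tri 164, .tri 388, .tri 148, .tri 276,
    .split 120, .split 216, .tri 88, .tri 200, .tri 208, .tri 224, .tri 336,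
    .known 6 [1, 5, 7, 6, 3, 4, 8, 2], .tri 88, .tri 152, .tri 336, .tri 400, .tri 112,
    .known 6 [1, 3, 5, 4, 7, 8, 6, 2], .tri 56, .tri 104, .tri 304, .tri 328, .tri 336, .tri 352,
    .tri 392, .known 6 [6, 5, 8, 3, 7, 1, 4, 2], .tri 44, .tri 168, .tri 224, .ring 5 7 1 3 6,
    .split 404, .known 19 [1, 2, 7, 6, 5, 4, 3, 8], .tri 388, .tri 196, .tri 324, .tri 76,
    .tri 84, .tri 140, .split 120, .tri 88, .tri 152, .tri 208, .edge 4 7, .tri 56, .tri 104,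
    .tri 328, .tri 392, .tri 88, .known 20 [4, 3, 5, 1, 2, 6, 7, 8], .tri 42, .tri 138,
    .split 356, .known 20 [1, 2, 5, 4, 3, 8, 7, 6], .split 180, .tri 52, .tri 100, .tri 44,
    .tri 76, .tri 140, .ring 2 7 3 4 5, .split 108, .tri 44, .tri 76, .tri 140, .tri 164,
    .tri 292, .tri 388, .tri 148, .tri 276, .split 226, .tri 162,
    .known 20 [1, 5, 2, 6, 7, 8, 3, 4], .tri 98, .tri 194, .split 120, .tri 56, .tri 104,
    .tri 168, .tri 416, .tri 304, .tri 336, .tri 448, .tri 88, .known 6 [7, 3, 8, 5, 6, 4, 1, 2],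
    .split 184, .tri 56, .tri 168, .tri 296, .ring 5 8 1 3 6, .tri 56, .tri 296, .tri 104,
    .ring 3 5 2 6 7, .tri 44, .tri 100, .tri 164, .tri 292, .split 212, .tri 84, .tri 196,
    .tri 324, .split 92, .tri 28, .tri 76, .tri 84, .tri 148, .tri 196, .split 226, .tri 98,
    .tri 162, .split 120, .tri 56, .tri 88, .tri 112, .tri 152, .tri 176, .tri 208, .edge 4 7,
    .split 232, .tri 104, .tri 224, .tri 296, .tri 352, .tri 416, .tri 56,
    .known 20 [4, 5, 3, 1, 2, 6, 8, 7], .split 240, .tri 112, .split 184, .tri 56, .tri 168,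
    .tri 176, .split 216, .tri 88, .tri 152, .tri 208, .edge 4 8, .tri 88, .tri 152, .tri 208,
    .known 1 [7, 6, 2, 1, 5, 4, 3, 8], .tri 56, .tri 168, .tri 176, .split 216, .tri 152,
    .tri 200, .known 0 [7, 6, 2, 1, 5, 4, 3, 8], .tri 152, .tri 200, .edge 3 7, .tri 224,
    .tri 416, .tri 448, .tri 168, .tri 200, .tri 392, .edge 3 7, .tri 194, .tri 448,
    .ring 6 7 1 2 8, .ring 7 8 1 2 6, .tri 152, .edge 3 7, .tri 28, .tri 76, .tri 84, .tri 148,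
    .tri 196, .split 120, .known 20 [4, 2, 3, 1, 5, 6, 8, 7], .split 216, .tri 88, .tri 336,
    .tri 112, .ring 6 8 2 3 4, .tri 98, .known 20 [6, 2, 7, 1, 5, 4, 8, 3], .tri 88, .split 184,
    .split 226, .tri 98, .tri 162, .tri 194, .split 232, .tri 104, .tri 168, .tri 224, .tri 352,
    .tri 416, .known 17 [3, 8, 2, 7, 1, 6, 4, 5], .tri 168, .tri 200, .tri 416, .tri 448,
    .tri 176, .known 20 [6, 7, 2, 1, 5, 4, 8, 3], .tri 98, .tri 194, .split 232, .tri 104,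
    .tri 200, .tri 352, .tri 448, .known 20 [8, 6, 1, 5, 3, 2, 4, 7], .tri 200, .tri 448,
    .tri 336, .known 20 [6, 8, 2, 4, 5, 1, 7, 3], .tri 56, .tri 152, .tri 296, .tri 328,
    .known 20 [3, 8, 4, 5, 1, 2, 6, 7]]),
  ([30, 54, 102, 198, 390, 270, 58, 354, 116], [
    .tri 14, .tri 22, .tri 26, .tri 38, .tri 50, .tri 52, .tri 70, .tri 98, .tri 100,
    .ring 1 4 2 3 5, .ring 2 5 1 4 6, .split 170, .tri 42, .tri 162, .tri 386, .tri 266,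
    .known 21 [5, 1, 6, 2, 4, 3, 7, 8], .tri 42, .tri 162, .tri 266, .tri 322, .tri 74,
    .split 332, .known 21 [1, 2, 3, 4, 5, 6, 7, 8], .split 340, .tri 84, .tri 324, .tri 388,
    .tri 448, .tri 76, .tri 140, .ring 6 7 1 2 8, .ring 7 8 1 2 6, .tri 152, .edge 3 7, .split 92,
    .tri 28, .tri 76, .tri 84, .tri 140, .tri 148, .split 120, .tri 56, .tri 88, .tri 112,
    .tri 152, .tri 176, .tri 208, .edge 4 7, .split 232, .tri 104, .tri 200, .tri 296, .tri 328,
    .tri 392, .tri 56, .known 21 [4, 3, 2, 1, 5, 7, 8, 6], .split 216, .tri 88, .split 184,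
    .tri 56, .tri 152, .tri 168, .split 240, .tri 112, .tri 176, .tri 208, .edge 4 8, .tri 112,
    .tri 176, .tri 208, .known 3 [8, 1, 2, 3, 4, 6, 7, 5], .tri 152, .tri 168, .split 240,
    .tri 176, .tri 224, .known 21 [8, 7, 3, 2, 1, 6, 5, 4], .tri 176, .tri 224, .edge 5 7,
    .tri 200, .tri 392, .tri 448, .tri 152, .tri 208, .tri 400, .edge 4 7, .tri 76, .tri 84,
    .split 156, .tri 28, .tri 140, .tri 148, .split 120, .tri 56, .tri 112, .tri 176, .split 216,
    .tri 88, .tri 152, .tri 208, .edge 4 8, .tri 152, .tri 392, .tri 416, .tri 168, .edge 5 7,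
    .split 216, .tri 88, .tri 152, .tri 208, .tri 280, .tri 296, .tri 336, .tri 352, .tri 400,
    .tri 104, .edge 5 7, .tri 88, .split 360, .tri 104, .tri 200, .tri 296, .tri 352, .tri 392,
    .tri 416, .tri 448, .edge 4 8, .tri 104, .tri 200, .edge 3 6, .tri 28, .tri 140, .tri 148,
    .split 216, .known 21 [2, 4, 6, 5, 1, 3, 8, 7], .split 240,
    .known 21 [4, 2, 7, 6, 5, 1, 3, 8], .tri 208, .tri 400, .tri 448, .tri 152, .tri 200,
    .tri 392, .edge 3 7]),
  ([30, 54, 102, 198, 390, 270, 58, 354], [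
    .tri 14, .tri 22, .tri 26, .tri 38, .tri 50, .tri 98, .ring 1 4 2 3 5, .split 60, .tri 28,
    .tri 52, .tri 56, .ring 2 4 1 3 5, .ring 3 4 1 2 5, .ring 4 5 1 2 3, .tri 208, .edge 4 6,
    .split 116, .known 22 [1, 2, 3, 4, 5, 6, 7, 8], .split 332,
    .known 21 [1, 2, 3, 4, 5, 6, 7, 8], .split 356, .known 21 [1, 2, 5, 4, 3, 8, 7, 6],
    .split 394, .tri 266, .tri 290, .tri 386, .split 170, .tri 42, .tri 138, .tri 162, .tri 266,
    .split 108, .split 184, .ring 3 5 1 4 7, .split 156, .tri 28, .tri 76, .tri 140, .tri 200,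
    .tri 268, .tri 152, .tri 168, .tri 296, .tri 328, .tri 56, .known 21 [4, 3, 2, 1, 5, 6, 8, 7],
    .split 92, .tri 76, .split 172, .tri 140, .known 21 [1, 3, 2, 4, 5, 7, 6, 8], .tri 44,
    .split 120, .ring 3 6 2 4 5, .tri 56, .tri 296, .tri 104, .known 21 [1, 5, 3, 4, 2, 6, 8, 7],
    .tri 28, .tri 76, .tri 268, .tri 44, .ring 2 3 5 6 7, .tri 100,
    .known 21 [1, 5, 2, 4, 3, 7, 8, 6], .tri 42, .tri 138, .tri 194, .tri 266, .split 108,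
    .known 21 [1, 2, 6, 7, 8, 3, 4, 5], .tri 100, .tri 196, .tri 76, .split 172, .tri 44,
    .tri 164, .tri 268, .tri 388, .known 22 [2, 1, 5, 6, 7, 8, 3, 4], .tri 44, .split 156,
    .tri 140, .known 22 [1, 2, 6, 7, 8, 3, 4, 5], .tri 28, .split 180,
    .known 22 [2, 1, 8, 3, 4, 5, 6, 7], .tri 52, .tri 164, .split 312, .tri 56, .tri 280,
    .tri 296, .tri 328, .tri 88, .tri 104, .edge 3 6, .split 360, .ring 5 8 1 3 6, .tri 296,
    .tri 416, .tri 304, .split 120, .tri 104, .known 21 [6, 5, 1, 2, 7, 3, 4, 8], .tri 56,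
    .tri 112, .known 21 [4, 5, 2, 1, 3, 7, 6, 8]]),
  ([30, 54, 102, 198, 390, 270, 58], [
    .tri 14, .tri 22, .tri 26, .tri 38, .tri 50, .tri 70, .ring 1 4 2 3 5, .split 60, .tri 28,
    .tri 52, .tri 56, .ring 2 4 1 3 5, .ring 3 4 1 2 5, .ring 4 5 1 2 3, .tri 208, .edge 4 6,
    .split 330, .known 23 [1, 2, 5, 4, 3, 8, 7, 6], .split 354,
    .known 23 [1, 2, 3, 4, 5, 6, 7, 8], .tri 322, .split 332, .known 21 [1, 2, 3, 4, 5, 6, 7, 8],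
    .split 356, .known 21 [1, 2, 5, 4, 3, 8, 7, 6], .split 452, .tri 196, .tri 324, .tri 388,
    .ring 2 7 1 6 8, .split 92, .tri 28, .tri 76, .tri 276, .known 23 [2, 6, 1, 7, 8, 4, 3, 5],
    .tri 28, .tri 76, .tri 84, .tri 268, .tri 276, .split 106, .tri 74,
    .known 21 [2, 1, 6, 5, 4, 3, 8, 7], .tri 74, .tri 98, .split 170, .tri 42, .tri 138, .tri 162,
    .split 120, .tri 56, .tri 112, .tri 176, .split 216, .tri 152, .tri 392, .tri 416, .tri 296,
    .edge 5 8, .tri 152, .tri 208, .edge 4 7, .split 232, .tri 104, .tri 168, .tri 224, .tri 296,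
    .tri 352, .tri 416, .tri 280, .tri 336, .tri 88, .edge 4 7, .tri 104, .split 344, .tri 280,
    .tri 296, .tri 336, .tri 352, .tri 400, .edge 5 8, .tri 88, .tri 200, .edge 3 6, .tri 162,
    .known 21 [2, 1, 8, 3, 4, 5, 6, 7], .tri 324, .split 106, .tri 42, .tri 74, .tri 138,
    .split 92, .known 21 [1, 3, 2, 8, 7, 6, 5, 4], .split 108, .tri 76, .tri 100, .tri 104,
    .tri 196, .tri 200, .tri 328, .ring 5 6 1 2 3, .ring 6 7 1 2 3, .edge 4 6, .tri 76,
    .split 116, .known 21 [2, 1, 6, 5, 4, 3, 8, 7], .tri 100, .split 180, .tri 52, .tri 164,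
    .split 156, .tri 28, .tri 140, .tri 148, .tri 392, .ring 3 8 1 2 7, .ring 7 8 1 2 3, .tri 304,
    .edge 4 8, .tri 28, .known 23 [2, 1, 8, 3, 4, 5, 6, 7], .tri 52,
    .known 23 [2, 1, 7, 6, 5, 4, 3, 8], .tri 74, .tri 98, .split 228, .tri 100, .tri 196,
    .tri 224, .tri 76, .ring 5 6 1 2 7, .ring 6 7 1 2 5, .tri 88, .edge 3 6, .split 284, .tri 28,
    .ring 2 3 1 4 8, .tri 100, .tri 196, .tri 52, .tri 148, .known 21 [1, 2, 7, 6, 5, 4, 3, 8],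
    .split 308, .known 21 [1, 2, 5, 6, 7, 8, 3, 4], .tri 276, .split 108, .tri 100, .tri 52,
    .split 172, .tri 44, .tri 268, .tri 140, .tri 28, .known 23 [2, 3, 1, 8, 7, 5, 6, 4], .tri 44,
    .tri 164, .split 170, .tri 138, .split 92, .known 21 [1, 2, 3, 8, 7, 6, 5, 4], .tri 28,
    .tri 76, .tri 84, .split 120, .tri 56, .tri 104, .tri 168, .tri 392, .tri 416, .tri 448,
    .tri 280, .tri 304, .edge 4 8, .split 184, .tri 56, .tri 152, .tri 176, .tri 208, .tri 280,
    .tri 304, .edge 4 6, .tri 56, .tri 296, .tri 104, .tri 200, .tri 224, .tri 328, .tri 352,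
    .tri 448, .edge 4 6, .tri 42, .tri 162, .tri 296, .tri 416, .tri 304, .ring 3 8 1 2 5,
    .ring 7 8 1 2 5, .edge 4 8, .tri 100, .split 92, .tri 76, .known 23 [2, 1, 4, 5, 6, 7, 8, 3],
    .tri 28, .known 23 [2, 1, 6, 5, 4, 3, 8, 7]]),
  ([30, 54, 102, 198, 390, 270, 108, 90], [
    .tri 14, .tri 22, .tri 26, .tri 38, .tri 70, .tri 100, .split 60,
    .known 24 [2, 1, 3, 4, 5, 6, 7, 8], .split 114, .known 24 [1, 2, 4, 5, 6, 7, 8, 3],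
    .split 226, .ring 1 6 2 5 7, .split 284, .tri 28, .tri 268, .tri 44, .tri 76, .ring 2 3 5 6 7,
    .split 394, .tri 386, .ring 1 8 2 3 7, .tri 50, .tri 98, .tri 162,
    .known 24 [1, 3, 2, 8, 7, 5, 6, 4], .split 396, .tri 268, .tri 44, .tri 140, .tri 28,
    .known 24 [3, 2, 1, 4, 6, 5, 7, 8], .split 450, .tri 194, .tri 82, .tri 322, .tri 74,
    .known 24 [6, 1, 2, 5, 3, 4, 8, 7], .split 452, .tri 196, .ring 2 7 1 6 8, .tri 28, .tri 84,
    .known 24 [2, 6, 1, 7, 8, 4, 3, 5], .split 172, .tri 44, .tri 268, .tri 324, .tri 76, .tri 84,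
    .tri 140, .tri 148, .tri 164, .tri 276, .split 170, .tri 138, .tri 168, .tri 194, .tri 74,
    .tri 82, .tri 98, .tri 266, .tri 290, .tri 336, .tri 386, .tri 50, .split 120, .tri 56,
    .tri 88, .tri 112, .tri 152, .tri 200, .tri 224, .known 4 [4, 3, 2, 5, 1, 7, 6, 8], .tri 88,
    .ring 3 6 1 4 7, .tri 138, .tri 194, .known 24 [7, 2, 1, 6, 4, 3, 5, 8], .tri 44, .tri 268,
    .tri 324, .split 202, .tri 74, .tri 98, .tri 266, .tri 290, .tri 322, .tri 386,
    .known 24 [8, 1, 2, 3, 5, 6, 4, 7], .tri 138, .tri 194, .tri 82, .split 92, .tri 28, .tri 76,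
    .tri 84, .tri 88, .ring 3 4 1 2 6, .ring 6 7 1 2 4, .tri 168, .edge 3 7, .tri 28, .tri 76,
    .tri 84, .split 106, .tri 42, .tri 74, .tri 98, .tri 104, .ring 5 6 1 2 3, .ring 3 8 1 2 5,
    .tri 88, .tri 208, .edge 6 8, .tri 74, .tri 98, .split 216, .tri 88, .tri 200, .tri 328,
    .known 24 [6, 3, 1, 4, 7, 2, 5, 8], .split 120, .tri 104, .tri 200, .split 178, .tri 50,
    .tri 162, .split 180, .ring 4 5 1 2 7, .tri 52, .tri 148, .split 184, .tri 56, .tri 168,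
    .tri 176, .tri 208, .tri 304, .known 9 [6, 2, 5, 7, 1, 3, 4, 8], .tri 56, .tri 304, .tri 112,
    .ring 4 7 1 5 6, .tri 50, .tri 146, .split 180, .tri 164, .split 184, .ring 4 7 2 3 5,
    .tri 56, .tri 152, .tri 304, .tri 352, .tri 112, .known 8 [4, 8, 2, 6, 3, 1, 5, 7], .tri 52,
    .tri 304, .tri 56, .tri 112, .ring 4 5 3 6 7, .tri 88, .tri 328, .tri 104, .ring 3 6 2 5 7]),
  ([30, 54, 102, 198, 390, 270, 108], [
    .tri 14, .tri 22, .tri 100, .split 58, .known 24 [1, 2, 3, 4, 5, 6, 7, 8], .split 60,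
    .known 24 [2, 1, 3, 4, 5, 6, 7, 8], .split 90, .known 25 [1, 2, 3, 4, 5, 6, 7, 8], .split 154,
    .split 114, .known 24 [1, 2, 4, 5, 6, 7, 8, 3], .split 284, .tri 28, .tri 268, .tri 44,
    .tri 76, .ring 2 3 5 6 7, .split 204, .tri 76, .tri 28, .tri 140, .tri 268,
    .known 24 [3, 2, 1, 4, 7, 6, 5, 8], .split 92, .tri 28, .split 172, .tri 140,
    .known 24 [2, 3, 1, 8, 7, 5, 6, 4], .tri 44, .split 178, .split 212,
    .known 25 [1, 2, 4, 5, 6, 7, 8, 3], .tri 84, .tri 196, .known 24 [2, 6, 1, 7, 8, 4, 3, 5],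
    .tri 50, .known 25 [2, 1, 8, 3, 4, 5, 6, 7], .tri 28, .tri 76, .tri 268, .tri 44,
    .known 24 [3, 2, 1, 4, 7, 5, 6, 8], .tri 26, .known 24 [1, 2, 4, 3, 8, 7, 6, 5]]),
  ([30, 54, 102, 198, 390, 270], [
    .split 58, .known 24 [1, 2, 3, 4, 5, 6, 7, 8], .split 90, .known 26 [2, 1, 6, 5, 4, 3, 8, 7],
    .split 154, .known 26 [2, 1, 7, 8, 3, 4, 5, 6], .tri 26, .known 24 [1, 2, 4, 3, 8, 7, 6, 5]]),
  ([30, 54, 102, 198, 142, 212], [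
    .tri 14, .tri 22, .tri 38, .tri 70, .tri 134, .tri 196, .split 60, .ring 2 4 1 3 5,
    .split 116, .tri 52, .tri 84, .tri 100, .tri 324, .ring 2 5 1 4 6, .split 156, .tri 28,
    .tri 140, .tri 148, .edge 2 8, .tri 28, .tri 148, .known 27 [4, 2, 3, 1, 5, 6, 7, 8],
    .split 156, .tri 28, .tri 84, .tri 148, .tri 276, .known 27 [4, 2, 3, 1, 5, 8, 6, 7],
    .split 92, .tri 28, .tri 84, .split 108, .tri 76, .tri 100, .split 172, .tri 44, .tri 140,
    .split 180, .tri 52, .tri 148, .tri 164, .edge 2 8, .tri 52, .tri 148,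
    .known 27 [4, 2, 3, 1, 5, 8, 7, 6], .tri 44, .tri 140, .known 27 [3, 2, 4, 1, 7, 8, 5, 6],
    .tri 76, .tri 100, .known 27 [6, 2, 5, 1, 7, 4, 3, 8], .tri 28, .tri 84, .tri 276, .tri 52,
    .known 27 [4, 2, 3, 1, 5, 7, 6, 8]]),
  ([30, 54, 102, 198, 142, 282, 156], [
    .tri 22, .tri 28, .split 180, .known 28 [1, 2, 3, 7, 6, 5, 4, 8], .split 212,
    .known 28 [1, 2, 3, 4, 5, 6, 7, 8], .tri 148, .split 116, .tri 84,
    .known 27 [4, 2, 3, 1, 5, 6, 8, 7], .tri 52, .known 28 [2, 4, 5, 8, 7, 3, 1, 6]]),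
  ([30, 54, 102, 198, 142, 282], [
    .tri 14, .tri 26, .split 60, .known 29 [1, 2, 4, 3, 7, 6, 5, 8], .split 92,
    .known 28 [1, 2, 5, 6, 7, 3, 4, 8], .split 156, .known 29 [1, 2, 3, 4, 5, 6, 7, 8], .tri 28,
    .tri 280, .ring 3 4 1 2 8, .split 106, .known 28 [2, 1, 4, 3, 7, 6, 5, 8], .split 170,
    .known 28 [2, 1, 4, 5, 6, 7, 3, 8], .tri 42, .split 202, .tri 74,
    .known 29 [1, 3, 4, 2, 7, 6, 8, 5], .tri 138, .split 108, .known 28 [1, 2, 4, 3, 7, 6, 5, 8],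
    .split 172, .known 28 [1, 2, 4, 5, 6, 7, 3, 8], .tri 44, .split 204, .tri 76,
    .known 29 [2, 3, 4, 1, 7, 6, 8, 5], .tri 140, .tri 392, .tri 168, .tri 296, .edge 3 5]),
  ([30, 54, 102, 198, 142], [
    .tri 22, .tri 38, .split 90, .known 28 [2, 1, 5, 6, 7, 3, 4, 8], .split 106,
    .known 28 [2, 1, 4, 3, 7, 6, 5, 8], .split 170, .known 28 [2, 1, 4, 5, 6, 7, 3, 8],
    .split 178, .known 28 [2, 1, 3, 7, 6, 5, 4, 8], .split 210,
    .known 28 [2, 1, 3, 4, 5, 6, 7, 8], .split 282, .known 30 [1, 2, 4, 3, 7, 6, 5, 8],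
    .split 114, .tri 50, .tri 82, .tri 98, .tri 274, .tri 26, .tri 138, .tri 194,
    .known 30 [1, 7, 6, 2, 3, 4, 8, 5], .split 226, .tri 162, .tri 194, .split 58, .tri 26,
    .tri 138, .known 30 [1, 7, 3, 2, 6, 5, 8, 4], .tri 50, .known 30 [1, 5, 4, 2, 6, 7, 8, 3],
    .tri 98, .known 30 [1, 2, 6, 5, 4, 3, 7, 8]]),
  ([30, 54, 102, 78, 204], [
    .tri 14, .tri 22, .tri 38, .tri 70, .tri 76, .tri 134, .split 60, .tri 28, .split 172,
    .known 31 [3, 2, 4, 1, 6, 7, 5, 8], .tri 44, .tri 140, .known 27 [3, 2, 4, 1, 6, 7, 8, 5],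
    .split 172, .tri 44, .tri 140, .tri 268, .known 27 [3, 2, 4, 1, 6, 7, 5, 8], .tri 44,
    .split 156, .tri 28, .tri 140, .split 116, .tri 52, .tri 100, .tri 164, .split 212, .tri 84,
    .tri 148, .tri 196, .edge 2 8, .tri 84, .tri 148, .known 27 [4, 2, 3, 1, 5, 6, 8, 7],
    .split 212, .tri 84, .tri 148, .tri 276, .known 27 [4, 2, 3, 1, 5, 8, 6, 7], .tri 84,
    .split 180, .tri 52, .tri 148, .split 228, .tri 100, .tri 164, .tri 196, .edge 2 8, .tri 100,
    .tri 196, .known 31 [6, 2, 3, 1, 5, 8, 7, 4], .tri 52, .tri 148,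
    .known 31 [4, 2, 3, 1, 5, 8, 7, 6], .tri 28, .tri 140, .known 31 [3, 2, 4, 1, 6, 7, 8, 5]]),
  ([30, 54, 102, 78], [
    .tri 14, .tri 22, .tri 38, .tri 70, .tri 134, .split 154, .known 32 [2, 1, 4, 5, 6, 3, 7, 8],
    .split 178, .known 32 [2, 1, 4, 3, 6, 5, 7, 8], .split 202,
    .known 32 [2, 1, 3, 4, 5, 6, 7, 8], .split 226, .known 32 [2, 1, 6, 3, 4, 5, 7, 8],
    .split 282, .known 32 [2, 1, 4, 5, 6, 3, 8, 7], .split 58, .tri 26, .tri 50, .ring 1 4 2 3 5,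
    .tri 194, .split 106, .tri 42, .tri 138, .tri 162, .edge 1 7, .tri 74, .tri 98,
    .known 32 [6, 1, 2, 3, 8, 5, 4, 7], .tri 26, .ring 1 3 2 4 6, .tri 162, .split 114, .tri 82,
    .tri 146, .tri 194, .edge 1 7, .tri 50, .known 32 [2, 1, 4, 3, 6, 5, 8, 7]]),
  ([30, 46, 300], [
    .tri 14, .tri 44, .split 284, .known 33 [3, 2, 4, 1, 5, 8, 6, 7], .split 92, .tri 28,
    .split 204, .tri 140, .known 27 [3, 2, 4, 1, 5, 8, 7, 6], .tri 76,
    .known 31 [3, 2, 4, 1, 5, 8, 6, 7], .tri 28, .split 204, .tri 76,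
    .known 27 [3, 2, 4, 1, 5, 8, 6, 7], .tri 140, .known 31 [3, 2, 4, 1, 5, 8, 7, 6]]),
  ([30, 46], [
    .tri 14, .split 86, .known 34 [3, 2, 1, 5, 4, 7, 8, 6], .split 90,
    .known 34 [2, 3, 1, 5, 4, 7, 8, 6], .split 102, .known 34 [3, 2, 1, 4, 5, 7, 8, 6],
    .split 106, .known 34 [2, 3, 1, 4, 5, 7, 8, 6], .split 150,
    .known 34 [3, 2, 1, 5, 4, 6, 8, 7], .split 54, .ring 1 2 3 4 5, .split 58, .tri 50,
    .ring 1 3 2 4 5, .ring 1 4 2 3 5, .ring 1 5 2 3 4, .tri 194, .edge 1 6, .split 154,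
    .known 34 [2, 3, 1, 5, 4, 6, 8, 7], .tri 26, .known 34 [2, 3, 1, 5, 4, 6, 7, 8], .tri 22,
    .known 34 [3, 2, 1, 5, 4, 6, 7, 8]])]

theorem verify_derivations : verify codes derivations = true := by decide +kernel

section Invariant

variable {α β : Type*} [DecidableEq α] [DecidableEq β]

/-- A numerical invariant of a family of sets, built from the degrees of the pairs of elements. -/
def weight (F : Finset (Finset α)) : ℕ :=
  ∑ σ ∈ F, (∑ u ∈ σ, ∑ v ∈ σ, (F.filter fun τ => u ∈ τ ∧ v ∈ τ).card ^ 2) ^ 2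

theorem weight_image {F : Finset (Finset α)} {S : Finset α} (hF : ∀ σ ∈ F, σ ⊆ S) {f : α → β}
    (hf : Set.InjOn f S) : weight (F.image fun σ => σ.image f) = weight F := by
  have mem {u : α} (hu : u ∈ S) {τ : Finset α} (hτ : τ ∈ F) : f u ∈ τ.image f ↔ u ∈ τ := by
    refine ⟨fun h => ?_, Finset.mem_image_of_mem f⟩
    obtain ⟨w, hw, e⟩ := Finset.mem_image.1 h
    exact hf (hF τ hτ hw) hu e ▸ hw
  have inj : Set.InjOn (fun σ : Finset α => σ.image f) F := by
    intro σ hσ τ hτ (h : σ.image f = τ.image f)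
    ext x
    constructor
    · intro hx
      exact (mem (hF σ hσ hx) hτ).1 (h ▸ Finset.mem_image_of_mem f hx)
    · intro hx
      exact (mem (hF τ hτ hx) hσ).1 (h ▸ Finset.mem_image_of_mem f hx)
  rw [weight, Finset.sum_image inj]
  refine Finset.sum_congr rfl fun σ hσ => ?_
  rw [Finset.sum_image (hf.mono (Finset.coe_subset.2 (hF σ hσ)))]
  congr 1
  refine Finset.sum_congr rfl fun u hu => ?_
  rw [Finset.sum_image (hf.mono (Finset.coe_subset.2 (hF σ hσ)))]
  refine Finset.sum_congr rfl fun v hv => ?_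
  rw [Finset.filter_image,
    Finset.card_image_of_injOn (inj.mono (Finset.coe_subset.2 (Finset.filter_subset _ _)))]
  congr 2
  exact Finset.filter_congr fun τ hτ => and_congr (mem (hF σ hσ hu) hτ) (mem (hF σ hσ hv) hτ)

theorem Iso.weight_eq {K : Complex α} {L : Complex β} (h : Iso K L) (d : ℕ) :
    weight (facets L d) = weight (facets K d) := by
  obtain ⟨f, hf, rfl⟩ := h
  have hK : ∀ σ ∈ K, σ ⊆ verts K := fun σ hσ v hv => mem_verts.2 ⟨σ, hσ, hv⟩
  rw [← weight_image (fun σ hσ => hK σ (mem_facets.1 hσ).1) hf, facets, facets, Finset.filter_image]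
  congr 2
  refine Finset.filter_congr fun σ hσ => ?_
  rw [Finset.card_image_of_injOn (hf.mono (Finset.coe_subset.2 (hK σ hσ)))]

theorem nodup_weight : (codes.map fun C => weight (faces C)).Nodup := by
  decide +kernel

end Invariant

end NPM

open NPM

/-- the 19 complexes are pairwise non-isomorphic neighbourly
normal 3-pseudomanifolds on 8 vertices, and every neighbourly normal
3-pseudomanifold on 8 vertices is isomorphic to one of them. -/
theorem statement1 :
    (∀ X ∈ L19, NPM.NormalPM X 3 ∧ NPM.Neighbourly X ∧ (NPM.verts X).card = 8) ∧
    L19.Pairwise (fun X Y => ¬ NPM.Iso X Y) ∧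
    (∀ (α : Type u) [DecidableEq α] (K : NPM.Complex α),
      NPM.NormalPM K 3 → NPM.Neighbourly K → (NPM.verts K).card = 8 →
        ∃ X ∈ L19, NPM.Iso K X) := by
  rw [L19_eq]
  refine ⟨?_, ?_, fun α _ K hK hN h8 => ?_⟩
  · rw [List.forall_mem_map]
    intro C hC
    have h := good_of_mem_codes hC
    exact ⟨normalPM_of_good h, neighbourly_of_good h, by rw [verts_of_good h, Nat.card_Icc]⟩
  · rw [List.pairwise_map]
    refine (List.pairwise_map.1 nodup_weight).imp_of_mem fun {A B} hA hB hne h => hne ?_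
    rw [← facets_of_good (good_of_mem_codes hA), ← facets_of_good (good_of_mem_codes hB)]
    exact (h.weight_eq 3).symm
  · rw [← L19_eq]
    obtain ⟨f, hf, h⟩ := exists_labelling hK h8
    refine known_of_verify hK hN codes (fun C hC => ?_) derivations verify_derivations
      ([30, 46], _) (List.mem_of_getElem? (i := 16) rfl) f hf h
    exact known_of_good hK (good_of_mem_codes hC) (L19_eq ▸ List.mem_map_of_mem hC)
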